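/- arXiv:2109.14472 — 10 statements merged into one kernel-verified Lean document; each statement's English description precedes it below -/
import Mathlib

section
/- Let N ≥ 4 be an integer and let x_1,…,x_N, y_1,…,y_N be nonnegative real numbers. If ∑_{j=1}^N x_j = ∑_{j=1}^N y_j, ∏_{j=1}^N x_j = ∏_{j=1}^N y_j, and ∑_{k=1}^N ∏_{j≠k} x_j = ∑_{k=1}^N ∏_{j≠k} y_j, then max_j x_j ≤ (N−2) · max_j y_j. -/
theorem prod_le_sum_div_card_pow {ι : Type*} {s : Finset ι} {f : ι → ℝ}
    (hf : ∀ j ∈ s, 0 ≤ f j) :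
    ∏ j ∈ s, f j ≤ ((∑ j ∈ s, f j) / s.card) ^ s.card := by
  rcases s.eq_empty_or_nonempty with rfl | hs
  · simp
  have hc : (0 : ℝ) < s.card := by exact_mod_cast hs.card_pos
  have hamgm := Real.geom_mean_le_arith_mean s (fun _ => 1) f (by simp) (by simpa using hc) hf
  simp only [Real.rpow_one, Finset.sum_const, nsmul_eq_mul, mul_one, one_mul] at hamgm
  have hP : 0 ≤ ∏ j ∈ s, f j := Finset.prod_nonneg hf
  calc ∏ j ∈ s, f j = ((∏ j ∈ s, f j) ^ ((s.card : ℝ)⁻¹)) ^ s.card :=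
        (Real.rpow_inv_natCast_pow hP hs.card_pos.ne').symm
    _ ≤ _ := pow_le_pow_left₀ (Real.rpow_nonneg hP _) hamgm _

/-- The elementary symmetric polynomial of degree one less than the number of variables. -/
noncomputable def coprodSum {ι : Type*} [DecidableEq ι] (s : Finset ι) (f : ι → ℝ) : ℝ :=
  ∑ k ∈ s, ∏ j ∈ s.erase k, f j

section coprodSum

variable {ι : Type*} [DecidableEq ι] {s : Finset ι} {f : ι → ℝ}

theorem coprodSum_insert {a : ι} (ha : a ∉ s) :
    coprodSum (insert a s) f = ∏ j ∈ s, f j + f a * coprodSum s f := by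
  unfold coprodSum
  rw [Finset.sum_insert ha, Finset.erase_insert ha, Finset.mul_sum]
  congr 1
  refine Finset.sum_congr rfl fun k hk => ?_
  have hak : a ≠ k := fun h => ha (h ▸ hk)
  rw [Finset.erase_insert_of_ne hak, Finset.prod_insert]
  exact fun h => ha (Finset.mem_of_mem_erase h)

@[simp]
theorem coprodSum_empty : coprodSum (∅ : Finset ι) f = 0 := by
  simp [coprodSum]

theorem coprodSum_div (c : ℝ) :
    coprodSum s (fun j => f j / c) = coprodSum s f / c ^ (s.card - 1) := by
  unfold coprodSum
  rw [Finset.sum_div]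
  refine Finset.sum_congr rfl fun k hk => ?_
  rw [Finset.prod_div_distrib, Finset.prod_const, Finset.card_erase_of_mem hk]

theorem sum_sub_card_add_one_le_prod (h0 : ∀ j ∈ s, 0 ≤ f j) (h1 : ∀ j ∈ s, f j ≤ 1) :
    ∑ j ∈ s, f j - s.card + 1 ≤ ∏ j ∈ s, f j := by
  induction s using Finset.induction_on with
  | empty => simp
  | insert a s ha ih =>
    rw [Finset.forall_mem_insert] at h0 h1
    have hle : ∑ j ∈ s, f j ≤ s.card := by
      simpa using Finset.sum_le_card_nsmul s f 1 h1.2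
    have hih := ih h0.2 h1.2
    rw [Finset.sum_insert ha, Finset.prod_insert ha, Finset.card_insert_of_notMem ha]
    push_cast
    nlinarith [mul_le_mul_of_nonneg_left hih h0.1,
      mul_nonneg (sub_nonneg.2 h1.1) (sub_nonneg.2 hle)]

/-- The inequality is affine in each variable, with equality when at most two variables
differ from `1`. -/
theorem sum_sub_le_coprodSum_sub (h0 : ∀ j ∈ s, 0 ≤ f j) (h1 : ∀ j ∈ s, f j ≤ 1) :
    ∑ j ∈ s, f j - (s.card - 2) ≤ coprodSum s f - (s.card - 2) * ∏ j ∈ s, f j := by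
  induction s using Finset.induction_on with
  | empty => simp
  | insert a s ha ih =>
    rw [Finset.forall_mem_insert] at h0 h1
    have hprod := sum_sub_card_add_one_le_prod h0.2 h1.2
    have hih := ih h0.2 h1.2
    rw [Finset.sum_insert ha, Finset.prod_insert ha, Finset.card_insert_of_notMem ha,
      coprodSum_insert ha]
    push_cast
    nlinarith [mul_le_mul_of_nonneg_left hih h0.1,
      mul_nonneg (sub_nonneg.2 h1.1) (sub_nonneg.2 hprod)]

theorem coprodSum_le (hf : ∀ j ∈ s, 0 ≤ f j) (hs : 2 ≤ s.card) :
    coprodSum s f ≤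
      ((∑ j ∈ s, f j) / (s.card - 1)) ^ (s.card - 2) * ∑ j ∈ s, f j := by
  have hc : (2 : ℝ) ≤ s.card := by exact_mod_cast hs
  have hc1 : (0 : ℝ) < s.card - 1 := by linarith
  have hterm : ∀ k ∈ s, ∏ j ∈ s.erase k, f j ≤
      ((∑ j ∈ s, f j) / (s.card - 1)) ^ (s.card - 2) *
        ((∑ j ∈ s, f j - f k) / (s.card - 1)) := by
    intro k hk
    have hsum : ∑ j ∈ s.erase k, f j = ∑ j ∈ s, f j - f k := by
      rw [← Finset.sum_erase_add s f hk]; ring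
    have hcast : ((s.card - 1 : ℕ) : ℝ) = s.card - 1 := by
      rw [Nat.cast_sub (by omega)]; simp
    have hf' : ∀ j ∈ s.erase k, 0 ≤ f j := fun j hj => hf j (Finset.mem_of_mem_erase hj)
    have hamgm := prod_le_sum_div_card_pow hf'
    have hnn : 0 ≤ ∑ j ∈ s, f j - f k := hsum ▸ Finset.sum_nonneg hf'
    have hexp : s.card - 1 = (s.card - 2) + 1 := by omega
    rw [hsum, Finset.card_erase_of_mem hk, hcast, hexp, pow_succ] at hamgm
    refine hamgm.trans ?_
    have := hf k hk
    gcongr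
    linarith
  refine (Finset.sum_le_sum hterm).trans_eq ?_
  rw [← Finset.mul_sum, ← Finset.sum_div, Finset.sum_sub_distrib, Finset.sum_const, nsmul_eq_mul]
  field_simp

theorem mul_coprodSum_le_sum {M : ℝ} (hf : ∀ j ∈ s, 0 ≤ f j) (hs : 4 ≤ s.card)
    (hM : (s.card : ℝ) - 1 ≤ M) (hsum : M + ∑ j ∈ s, f j ≤ s.card + 1) :
    M * coprodSum s f ≤ ∑ j ∈ s, f j := by
  have ht0 : 0 ≤ ∑ j ∈ s, f j := Finset.sum_nonneg hf
  have hc : (4 : ℝ) ≤ s.card := by exact_mod_cast hs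
  have hM0 : 0 ≤ M := by linarith
  rcases hs.eq_or_lt' with h4 | h5
  · obtain ⟨a, u, ha, rfl, hu⟩ := Finset.card_eq_succ.1 h4
    obtain ⟨b, c, d, hbc, hbd, hcd, rfl⟩ := Finset.card_eq_three.1 hu
    have hb : b ∉ ({c, d} : Finset ι) := by simp [hbc, hbd]
    have hc' : c ∉ ({d} : Finset ι) := by simp [hcd]
    rw [h4] at hM hsum
    rw [← insert_empty_eq d] at *
    simp only [coprodSum_insert ha, coprodSum_insert hb, coprodSum_insert hc',
      coprodSum_insert (Finset.notMem_empty d), coprodSum_empty,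
      Finset.prod_insert hb, Finset.prod_insert hc',
      Finset.sum_insert ha, Finset.sum_insert hb, Finset.sum_insert hc',
      Finset.prod_insert (Finset.notMem_empty d), Finset.sum_insert (Finset.notMem_empty d),
      Finset.prod_empty, Finset.sum_empty, Finset.forall_mem_insert] at *
    obtain ⟨ha0, hb0, hc0, hd0, -⟩ := hf
    generalize f a = a' at *
    generalize f b = b' at *
    generalize f c = c' at *
    generalize f d = d' at *
    push_cast at hM hsum
    set t := a' + b' + c' + d' with ht
    have ht' : a' + (b' + (c' + (d' + 0))) = t := by rw [ht]; ring
    rw [ht'] at *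
    have ht2 : t ≤ 2 := by linarith
    have hE : b' * (c' * (d' * 1)) + a' * (c' * (d' * 1) + b' * (d' * 1 + c' * (1 + d' * 0)))
        ≤ t ^ 3 / 16 := by
      nlinarith [mul_nonneg (add_nonneg hc0 hd0) (sq_nonneg (a' - b')),
        mul_nonneg (add_nonneg ha0 hb0) (sq_nonneg (c' - d')),
        mul_nonneg ht0 (sq_nonneg (a' + b' - c' - d'))]
    refine (mul_le_mul_of_nonneg_left hE hM0).trans ?_
    have hMt : M * t ≤ 6 := by nlinarith
    nlinarith [mul_nonneg ht0 ht0, mul_nonneg ht0 (sub_nonneg.2 ht2)]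
  · have hc5 : (5 : ℝ) ≤ s.card := by exact_mod_cast h5
    have hE := coprodSum_le hf (by omega)
    set t := ∑ j ∈ s, f j
    set m : ℝ := (s.card : ℝ)
    have ht2 : t ≤ 2 := by linarith
    have hm1 : 0 < m - 1 := by linarith
    have hpow : (t / (m - 1)) ^ (s.card - 2) ≤ (t / (m - 1)) ^ 3 := by
      apply pow_le_pow_of_le_one (by positivity) _ (by omega)
      rw [div_le_one hm1]; linarith
    have hMt : M * t ≤ 2 * (m - 1) := by nlinarith
    have hone : M * (t / (m - 1)) ^ 3 ≤ 1 := by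
      rw [div_pow, ← mul_div_assoc, div_le_one (by positivity)]
      have htt : t ^ 2 ≤ 4 := by nlinarith
      have hmm : 8 ≤ (m - 1) ^ 2 := by nlinarith
      calc M * t ^ 3 = (M * t) * t ^ 2 := by ring
        _ ≤ (2 * (m - 1)) * 4 := by gcongr
        _ = (m - 1) * 8 := by ring
        _ ≤ (m - 1) * (m - 1) ^ 2 := by gcongr
        _ = (m - 1) ^ 3 := by ring
    calc M * coprodSum s f ≤ M * ((t / (m - 1)) ^ (s.card - 2) * t) := by gcongr
      _ ≤ M * ((t / (m - 1)) ^ 3 * t) := by gcongr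
      _ = (M * (t / (m - 1)) ^ 3) * t := by ring
      _ ≤ 1 * t := by gcongr
      _ = t := one_mul t

end coprodSum

/-- Schur's inequality of degree one, in terms of elementary symmetric polynomials. -/
theorem schur_three {a b c : ℝ} (ha : 0 ≤ a) (hb : 0 ≤ b) (hc : 0 ≤ c) :
    (a + b + c) * (4 * (a * b + b * c + c * a) - (a + b + c) ^ 2) ≤ 9 * (a * b * c) := by
  rcases le_total a b with hab | hab <;> rcases le_total b c with hbc | hbc <;>
    rcases le_total a c with hac | hac <;>
    nlinarith [mul_nonneg (sub_nonneg.2 hab) (sub_nonneg.2 hbc),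
      mul_nonneg (sub_nonneg.2 hab) (sub_nonneg.2 hac),
      mul_nonneg (sub_nonneg.2 hbc) (sub_nonneg.2 hac),
      mul_nonneg ha (mul_nonneg (sub_nonneg.2 hab) (sub_nonneg.2 hac)),
      mul_nonneg hb (mul_nonneg (sub_nonneg.2 hab) (sub_nonneg.2 hbc)),
      mul_nonneg hc (mul_nonneg (sub_nonneg.2 hbc) (sub_nonneg.2 hac)),
      mul_nonneg ha (sq_nonneg (b - c)), mul_nonneg hb (sq_nonneg (a - c)),
      mul_nonneg hc (sq_nonneg (a - b)), mul_nonneg ha (sq_nonneg (a - b)),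
      mul_nonneg hc (sq_nonneg (c - b)), mul_nonneg hb (sq_nonneg (a - b)),
      mul_nonneg ha (sq_nonneg (a - c)), mul_nonneg hb (sq_nonneg (b - c)),
      mul_nonneg hc (sq_nonneg (a - c))]

theorem four_variable_bound {M a b c : ℝ} (ha : 0 ≤ a) (hb : 0 ≤ b) (hc : 0 ≤ c)
    (hM : 2 < M) (hsum : M + (a + b + c) ≤ 4) :
    a * b * c + M * (a * b + b * c + c * a) - 2 * (M * (a * b * c)) < M + (a + b + c) - 2 := by
  have hschur := schur_three ha hb hc
  have he2 : 3 * (a * b + b * c + c * a) ≤ (a + b + c) ^ 2 := by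
    nlinarith [sq_nonneg (a - b), sq_nonneg (b - c), sq_nonneg (a - c)]
  have he3 : 0 ≤ a * b * c := by positivity
  have ht0 : 0 ≤ a + b + c := by positivity
  generalize a * b + b * c + c * a = p at *
  generalize a * b * c = q at *
  generalize a + b + c = t at *
  have ht2 : t < 2 := by linarith
  -- The difference of the two sides is affine in `M ∈ [2, 4 - t]`.
  have hleft : 2 * p - 3 * q - t ≤ 0 := by
    rcases le_total (4 * p) (t ^ 2) with hp | hp
    · nlinarith
    · rcases le_total t (3 / 2) with ht | ht
      · nlinarith
      · nlinarith [mul_nonneg (sub_nonneg.2 hp) (sub_nonneg.2 ht)]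
  have hright : (4 - t) * p - (7 - 2 * t) * q - 2 < 0 := by
    have hq7 : 0 < 7 - 2 * t := by linarith
    rcases le_total (4 * p) (t ^ 2) with hp | hp
    · have h1 : (4 - t) * (4 * p) ≤ (4 - t) * t ^ 2 :=
        mul_le_mul_of_nonneg_left hp (by linarith)
      have h2 : (4 - t) * t ^ 2 < 8 := by
        nlinarith [mul_pos (sub_pos.2 ht2) (by nlinarith : 0 < 4 + 2 * t - t ^ 2)]
      nlinarith [mul_nonneg hq7.le he3]
    · have h1 := mul_le_mul_of_nonneg_left hschur hq7.le
      -- Affine in `p ∈ [t ^ 2 / 4, t ^ 2 / 3]`.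
      rcases le_total (36 - 37 * t + 8 * t ^ 2) 0 with hk | hk
      · have h2 : (4 - t) * t ^ 2 < 8 := by
          nlinarith [mul_pos (sub_pos.2 ht2) (by nlinarith : 0 < 4 + 2 * t - t ^ 2)]
        nlinarith [mul_nonneg (sub_nonneg.2 hp) (sub_nonneg.2 hk)]
      · have h2 : t ^ 2 * (36 - 16 * t + 2 * t ^ 2) < 54 := by
          nlinarith [sq_nonneg (t * (t - 2)), sq_nonneg (t - 2), mul_nonneg ht0 (sq_nonneg (t - 2)),
            mul_nonneg ht0 (sub_pos.2 ht2).le]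
        nlinarith [mul_nonneg (sub_nonneg.2 he2) hk]
  have hw1 : 0 < M - 2 := by linarith
  have hw2 : 0 ≤ 4 - t - M := by linarith
  have hw : 0 < 2 - t := by linarith
  have hcomb : (2 - t) * (q + M * p - 2 * (M * q) - (M + t - 2)) < 0 := by
    nlinarith [mul_neg_of_pos_of_neg hw1 hright, mul_nonpos_of_nonneg_of_nonpos hw2 hleft]
  by_contra! hcon
  nlinarith [mul_nonneg hw.le (sub_nonneg.2 hcon)]

theorem coprodSum_sub_lt_sum_sub {ι : Type*} [DecidableEq ι] {s : Finset ι} {f : ι → ℝ}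
    (hf : ∀ j ∈ s, 0 ≤ f j) (hs : 4 ≤ s.card) {i : ι} (hi : i ∈ s)
    (hM : (s.card : ℝ) - 2 < f i) (hsum : ∑ j ∈ s, f j ≤ s.card) :
    coprodSum s f - (s.card - 2) * ∏ j ∈ s, f j < ∑ j ∈ s, f j - (s.card - 2) := by
  obtain ⟨u, hiu, rfl⟩ : ∃ u, i ∉ u ∧ insert i u = s :=
    ⟨s.erase i, Finset.notMem_erase i s, Finset.insert_erase hi⟩
  rw [Finset.forall_mem_insert] at hf
  rw [Finset.card_insert_of_notMem hiu] at *
  rw [Finset.sum_insert hiu] at *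
  rw [coprodSum_insert hiu, Finset.prod_insert hiu]
  have hu : 3 ≤ u.card := by omega
  push_cast at *
  rcases hu.eq_or_lt' with h3 | h4
  · rw [h3] at hM hsum ⊢
    obtain ⟨a, b, c, hab, hac, hbc, rfl⟩ := Finset.card_eq_three.1 h3
    have ha : a ∉ ({b, c} : Finset ι) := by simp [hab, hac]
    have hb : b ∉ ({c} : Finset ι) := by simp [hbc]
    obtain ⟨-, hf⟩ := hf
    have key := @four_variable_bound (f i) (f a) (f b) (f c) (hf a (by simp)) (hf b (by simp))
      (hf c (by simp))
    rw [← insert_empty_eq c] at *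
    simp only [coprodSum_insert ha, coprodSum_insert hb,
      coprodSum_insert (Finset.notMem_empty c), coprodSum_empty,
      Finset.prod_insert ha, Finset.prod_insert hb,
      Finset.sum_insert ha, Finset.sum_insert hb,
      Finset.prod_insert (Finset.notMem_empty c), Finset.sum_insert (Finset.notMem_empty c),
      Finset.prod_empty, Finset.sum_empty] at *
    push_cast at *
    linarith [key (by linarith) (by linarith)]
  · have hc : (4 : ℝ) ≤ u.card := by exact_mod_cast h4
    have hE := mul_coprodSum_le_sum hf.2 h4 (M := f i) (by linarith) hsum
    have hP : 0 ≤ ∏ j ∈ u, f j := Finset.prod_nonneg hf.2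
    have hcoef : 1 ≤ ((u.card : ℝ) + 1 - 2) * f i := by nlinarith
    nlinarith [mul_nonneg hP (sub_nonneg.2 hcoef)]

theorem four_mean_theorem (N : ℕ) (hN : 4 ≤ N) (x y : Fin N → ℝ)
    (hx : ∀ j, 0 ≤ x j) (hy : ∀ j, 0 ≤ y j)
    (hsum : ∑ j, x j = ∑ j, y j)
    (hprod : ∏ j, x j = ∏ j, y j)
    (hesym : ∑ k, ∏ j ∈ Finset.univ.erase k, x j
      = ∑ k, ∏ j ∈ Finset.univ.erase k, y j) :
    Finset.univ.sup' ⟨⟨0, by omega⟩, Finset.mem_univ _⟩ x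
      ≤ ((N : ℝ) - 2) * Finset.univ.sup' ⟨⟨0, by omega⟩, Finset.mem_univ _⟩ y := by
  have hyY : ∀ j, y j ≤ Finset.univ.sup' ⟨⟨0, by omega⟩, Finset.mem_univ _⟩ y :=
    fun j => Finset.le_sup' y (Finset.mem_univ j)
  generalize Finset.univ.sup' ⟨⟨0, by omega⟩, Finset.mem_univ _⟩ y = Y at *
  refine Finset.sup'_le _ _ fun i _ => ?_
  have hY0 : 0 ≤ Y := (hy i).trans (hyY i)
  rcases hY0.eq_or_lt with rfl | hY
  · have hle : x i ≤ ∑ j, x j :=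
      Finset.single_le_sum (fun j _ => hx j) (Finset.mem_univ i)
    have hy0 : ∑ j, y j ≤ 0 := Finset.sum_nonpos fun j _ => hyY j
    linarith
  by_contra! hlt
  have hylow := sum_sub_le_coprodSum_sub (s := Finset.univ) (f := fun j => y j / Y)
    (fun j _ => div_nonneg (hy j) hY0) (fun j _ => (div_le_one hY).2 (hyY j))
  have hsumy : ∑ j, y j / Y ≤ N := by
    simpa using Finset.sum_le_card_nsmul Finset.univ (fun j => y j / Y) 1
      (fun j _ => (div_le_one hY).2 (hyY j))
  have hsumxy : ∑ j, x j / Y = ∑ j, y j / Y := by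
    rw [← Finset.sum_div, ← Finset.sum_div, hsum]
  have hxup := coprodSum_sub_lt_sum_sub (s := Finset.univ) (f := fun j => x j / Y) (i := i)
    (fun j _ => div_nonneg (hx j) hY0) (by simpa using hN) (Finset.mem_univ i)
    (by simpa using (lt_div_iff₀ hY).2 hlt) (by simpa [hsumxy] using hsumy)
  have hE : coprodSum Finset.univ x = coprodSum Finset.univ y := hesym
  rw [coprodSum_div, Finset.prod_div_distrib] at hylow hxup
  rw [hsumxy, hE, hprod] at hxup
  exact absurd hylow (not_le.2 hxup)
end

section
/- Let N ≥ 4 be an integer and let x_1,…,x_N, y_1,…,y_N be nonnegative real numbers with ∑_{j=1}^N x_j = ∑_{j=1}^N y_j, ∏_{j=1}^N x_j = ∏_{j=1}^N y_j, and ∑_{k=1}^N ∏_{j≠k} x_j = ∑_{k=1}^N ∏_{j≠k} y_j. Then max_j x_j = (N−2) · max_j y_j holds if and only if there exists c ≥ 0 such that some x_i equals c·(N−2) and x_j = 0 for all j ≠ i, and there exists a set S ⊆ {1,…,N} of cardinality exactly 2 with y_j = 0 for j ∈ S and y_j = c for j ∉ S. -/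
/-- Recursion for the penultimate elementary symmetric polynomial of `f` on `insert a s`. -/
lemma sum_prod_erase_insert {ι : Type*} [DecidableEq ι] (f : ι → ℝ) {s : Finset ι} {a : ι}
    (ha : a ∉ s) :
    ∑ k ∈ insert a s, ∏ j ∈ (insert a s).erase k, f j
      = ∏ j ∈ s, f j + f a * ∑ k ∈ s, ∏ j ∈ s.erase k, f j := by
  rw [Finset.sum_insert ha, Finset.erase_insert ha, Finset.mul_sum]
  congr 1
  refine Finset.sum_congr rfl fun k hk => ?_
  have hak : a ≠ k := fun h => ha (h ▸ hk)
  rw [Finset.erase_insert_of_ne hak, Finset.prod_insert fun h => ha (Finset.mem_of_mem_erase h)]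

/-- Weighted AM-GM with integer weights `1` and `k`. -/
lemma succ_mul_mul_pow_le (k : ℕ) {m u : ℝ} (hm : 0 ≤ m) (hu : 0 ≤ u) :
    ((k : ℝ) + 1) * (m * u ^ k) ≤ m ^ (k + 1) + k * u ^ (k + 1) := by
  induction k with
  | zero => simp
  | succ k ih =>
    have hsign : 0 ≤ (m - u) * (m ^ (k + 1) - u ^ (k + 1)) := by
      rcases le_total m u with h | h
      · exact mul_nonneg_of_nonpos_of_nonpos (sub_nonpos.2 h)
          (sub_nonpos.2 (pow_le_pow_left₀ hm h _))
      · exact mul_nonneg (sub_nonneg.2 h) (sub_nonneg.2 (pow_le_pow_left₀ hu h _))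
    have ihu := mul_le_mul_of_nonneg_left ih hu
    push_cast
    ring_nf at hsign ihu ⊢
    linarith

/-- The Maclaurin inequalities for the last two elementary symmetric polynomials. -/
lemma prod_le_and_sum_prod_erase_le {ι : Type*} [DecidableEq ι] (f : ι → ℝ) (s : Finset ι)
    (hf : ∀ j ∈ s, 0 ≤ f j) :
    ∏ j ∈ s, f j ≤ ((∑ j ∈ s, f j) / s.card) ^ s.card ∧
    ∑ k ∈ s, ∏ j ∈ s.erase k, f j
      ≤ s.card * ((∑ j ∈ s, f j) / s.card) ^ (s.card - 1) := by
  induction s using Finset.induction_on with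
  | empty => simp
  | insert a s ha ih =>
    obtain ⟨ihP, ihE⟩ := ih fun j hj => hf j (Finset.mem_insert_of_mem hj)
    have ha0 : 0 ≤ f a := hf a (Finset.mem_insert_self _ _)
    have hσ : 0 ≤ ∑ j ∈ s, f j :=
      Finset.sum_nonneg fun j hj => hf j (Finset.mem_insert_of_mem hj)
    rw [sum_prod_erase_insert f ha, Finset.prod_insert ha, Finset.sum_insert ha,
      Finset.card_insert_of_notMem ha]
    generalize hk : s.card = k at *
    rcases k with _ | l
    · obtain rfl := Finset.card_eq_zero.1 hk
      simp
    generalize ∑ j ∈ s, f j = σ at *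
    generalize ∏ j ∈ s, f j = P at *
    generalize ∑ k ∈ s, ∏ j ∈ s.erase k, f j = E at *
    set u : ℝ := σ / ((l + 1 : ℕ) : ℝ) with hu
    set m : ℝ := (f a + σ) / ((l + 1 + 1 : ℕ) : ℝ) with hm
    have hu0 : 0 ≤ u := by positivity
    have hm0 : 0 ≤ m := by positivity
    have hσu : σ = ((l : ℝ) + 1) * u := by
      rw [hu]; push_cast; field_simp
    have ham : f a = ((l : ℝ) + 2) * m - ((l : ℝ) + 1) * u := by
      rw [← hσu, hm]; push_cast; field_simp; ring
    have hPa := mul_le_mul_of_nonneg_left ihP ha0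
    have hEa := mul_le_mul_of_nonneg_left ihE ha0
    simp only [Nat.add_sub_cancel] at *
    constructor
    · refine hPa.trans ?_
      have h := succ_mul_mul_pow_le (l + 1) hm0 hu0
      rw [ham]
      push_cast at h ⊢
      ring_nf at h ⊢
      linarith
    · refine (add_le_add ihP hEa).trans ?_
      have h := mul_le_mul_of_nonneg_left (succ_mul_mul_pow_le l hm0 hu0)
        (by positivity : (0 : ℝ) ≤ (l : ℝ) + 2)
      rw [ham]
      push_cast at h ⊢
      ring_nf at h ⊢
      linarith

/-- The Weierstrass product inequality, and its analogue for the last two elementary symmetric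
polynomials, on the unit cube. -/
lemma unit_cube_prod_bounds {ι : Type*} [DecidableEq ι] (f : ι → ℝ) (s : Finset ι)
    (hf : ∀ j ∈ s, 0 ≤ f j) (hf1 : ∀ j ∈ s, f j ≤ 1) :
    ∑ j ∈ s, f j - (s.card - 1) ≤ ∏ j ∈ s, f j ∧
    ∑ j ∈ s, f j - (s.card - 2)
      ≤ ∑ k ∈ s, ∏ j ∈ s.erase k, f j - (s.card - 2) * ∏ j ∈ s, f j := by
  induction s using Finset.induction_on with
  | empty => simp
  | insert a s ha ih =>
    have hs0 : ∀ j ∈ s, 0 ≤ f j := fun j hj => hf j (Finset.mem_insert_of_mem hj)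
    have hs1 : ∀ j ∈ s, f j ≤ 1 := fun j hj => hf1 j (Finset.mem_insert_of_mem hj)
    obtain ⟨ihW, ihE⟩ := ih hs0 hs1
    have ha0 : 0 ≤ f a := hf a (Finset.mem_insert_self _ _)
    have ha1 : f a ≤ 1 := hf1 a (Finset.mem_insert_self _ _)
    have hP1 : ∏ j ∈ s, f j ≤ 1 := Finset.prod_le_one hs0 hs1
    rw [sum_prod_erase_insert f ha, Finset.prod_insert ha, Finset.sum_insert ha,
      Finset.card_insert_of_notMem ha]
    push_cast
    constructor
    · nlinarith [mul_nonneg (sub_nonneg.2 ha1) (sub_nonneg.2 hP1)]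
    · linarith [mul_le_mul_of_nonneg_left ihW (sub_nonneg.2 ha1),
        mul_le_mul_of_nonneg_left ihE ha0]

/-- The constraints on the sum `t`, product `P` and penultimate elementary symmetric polynomial
`E` of the `n + 1` non-maximal entries force `t = 0`. -/
lemma eq_zero_of_symmetric_bounds {n : ℕ} (hn : 2 ≤ n) {t P E : ℝ} (ht0 : 0 ≤ t) (ht2 : t ≤ 2)
    (hP : 0 ≤ P) (hW : t - 1 ≤ n * P) (hE : t ≤ P + n * E - n * (n * P))
    (hM : E ≤ ((n : ℝ) + 1) * (t / ((n : ℝ) + 1)) ^ n) : t = 0 := by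
  by_contra hne
  have htpos : 0 < t := lt_of_le_of_ne ht0 (Ne.symm hne)
  rcases hn.eq_or_lt with rfl | hn3
  · norm_num at *
    rcases le_total t 1 with h | h
    · nlinarith
    · nlinarith
  · obtain ⟨l, rfl⟩ : ∃ l, n = l + 3 := ⟨n - 3, by omega⟩
    set q : ℝ := t / (((l + 3 : ℕ) : ℝ) + 1) with hq
    have hq0 : 0 ≤ q := by positivity
    have htq : t = (((l + 3 : ℕ) : ℝ) + 1) * q := by rw [hq]; field_simp
    have hq2 : q ≤ 1 / 2 := by
      rw [hq, div_le_iff₀ (by positivity)]; push_cast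
      have : (0 : ℝ) ≤ l := l.cast_nonneg
      linarith
    have hpow : q ^ (l + 2) ≤ (1 / 2) ^ (l + 2) := pow_le_pow_left₀ hq0 hq2 _
    have hlt : ((l + 3 : ℕ) : ℝ) < 2 ^ (l + 2) := by
      have : l + 3 < 2 ^ (l + 2) := by
        have := l.lt_two_pow_self
        rw [pow_add]; omega
      exact_mod_cast this
    have hlt1 : ((l + 3 : ℕ) : ℝ) * q ^ (l + 2) < 1 := by
      calc ((l + 3 : ℕ) : ℝ) * q ^ (l + 2) ≤ ((l + 3 : ℕ) : ℝ) * (1 / 2) ^ (l + 2) := by gcongr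
        _ < 2 ^ (l + 2) * (1 / 2) ^ (l + 2) := by gcongr
        _ = 1 := by rw [← mul_pow]; norm_num
    have hbound : ((l + 3 : ℕ) : ℝ) * E ≤ t * (((l + 3 : ℕ) : ℝ) * q ^ (l + 2)) := by
      refine (mul_le_mul_of_nonneg_left hM (Nat.cast_nonneg _)).trans_eq ?_
      rw [htq]; ring
    have hPle : P ≤ ((l + 3 : ℕ) : ℝ) * (((l + 3 : ℕ) : ℝ) * P) := by
      have h1 : (1 : ℝ) ≤ ((l + 3 : ℕ) : ℝ) := by exact_mod_cast (by omega : 1 ≤ l + 3)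
      nlinarith [mul_le_mul_of_nonneg_right h1 hP]
    have := mul_lt_mul_of_pos_left hlt1 htpos
    linarith

/-- If the last two elementary symmetric polynomials of nonnegative numbers vanish, two of the
numbers are zero. -/
lemma exists_pair_eq_zero {ι : Type*} [DecidableEq ι] {f : ι → ℝ} {s : Finset ι}
    (hf : ∀ j ∈ s, 0 ≤ f j) (hP : ∏ j ∈ s, f j = 0)
    (hE : ∑ k ∈ s, ∏ j ∈ s.erase k, f j = 0) :
    ∃ a ∈ s, ∃ b ∈ s, a ≠ b ∧ f a = 0 ∧ f b = 0 := by
  obtain ⟨a, ha, hfa⟩ := Finset.prod_eq_zero_iff.1 hP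
  have h := (Finset.sum_eq_zero_iff_of_nonneg fun k _ =>
    Finset.prod_nonneg fun j hj => hf j (Finset.mem_of_mem_erase hj)).1 hE a ha
  obtain ⟨b, hb, hfb⟩ := Finset.prod_eq_zero_iff.1 h
  exact ⟨a, ha, b, Finset.mem_of_mem_erase hb, (Finset.ne_of_mem_erase hb).symm, hfa, hfb⟩

/-- The rigidity statement, normalized so that `y` is bounded by `1`. -/
lemma rigidity_of_le_one (N : ℕ) (hN : 4 ≤ N) (x y : Fin N → ℝ)
    (hx : ∀ j, 0 ≤ x j) (hy : ∀ j, 0 ≤ y j) (hy1 : ∀ j, y j ≤ 1)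
    (hsum : ∑ j, x j = ∑ j, y j)
    (hprod : ∏ j, x j = ∏ j, y j)
    (hesym : ∑ k, ∏ j ∈ Finset.univ.erase k, x j
      = ∑ k, ∏ j ∈ Finset.univ.erase k, y j)
    (i : Fin N) (hi : x i = (N : ℝ) - 2) :
    (∀ j, j ≠ i → x j = 0) ∧
      ∃ S : Finset (Fin N), S.card = 2 ∧ (∀ j ∈ S, y j = 0) ∧ ∀ j ∉ S, y j = 1 := by
  obtain ⟨n, rfl⟩ : ∃ n, N = n + 2 := ⟨N - 2, by omega⟩
  have hxi : x i = n := by rw [hi]; push_cast; ring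
  obtain ⟨s, hs⟩ : ∃ s, s = (Finset.univ : Finset (Fin (n + 2))).erase i := ⟨_, rfl⟩
  have his : i ∉ s := by simp [hs]
  have huniv : (Finset.univ : Finset (Fin (n + 2))) = insert i s := by
    rw [hs, Finset.insert_erase (Finset.mem_univ i)]
  have hcard : s.card = n + 1 := by simp [hs]
  obtain ⟨hW, hC⟩ := unit_cube_prod_bounds y Finset.univ (fun j _ => hy j) fun j _ => hy1 j
  have hyN : ∑ j, y j ≤ (n : ℝ) + 2 := by
    simpa using Finset.sum_le_sum fun j (_ : j ∈ Finset.univ) => hy1 j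
  have hM := (prod_le_and_sum_prod_erase_le x s fun j _ => hx j).2
  have hsumx : ∑ j, x j = n + ∑ j ∈ s, x j := by rw [huniv, Finset.sum_insert his, hxi]
  have hprodx : ∏ j, x j = n * ∏ j ∈ s, x j := by rw [huniv, Finset.prod_insert his, hxi]
  have hesymx : ∑ k, ∏ j ∈ Finset.univ.erase k, x j
      = ∏ j ∈ s, x j + n * ∑ k ∈ s, ∏ j ∈ s.erase k, x j := by
    rw [huniv, sum_prod_erase_insert x his, hxi]
  have hP0 : 0 ≤ ∏ j ∈ s, x j := Finset.prod_nonneg fun j _ => hx j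
  have hE0 : 0 ≤ ∑ k ∈ s, ∏ j ∈ s.erase k, x j :=
    Finset.sum_nonneg fun k _ => Finset.prod_nonneg fun j _ => hx j
  have ht0 : 0 ≤ ∑ j ∈ s, x j := Finset.sum_nonneg fun j _ => hx j
  rw [← hsum, ← hprod, hsumx, hprodx, Finset.card_univ, Fintype.card_fin] at hW
  rw [← hsum, ← hprod, ← hesym, hsumx, hprodx, hesymx, Finset.card_univ, Fintype.card_fin] at hC
  rw [hcard, Nat.add_sub_cancel] at hM
  push_cast at hW hC hM
  have ht : ∑ j ∈ s, x j = 0 :=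
    eq_zero_of_symmetric_bounds (by omega : 2 ≤ n) ht0 (by linarith) hP0 (by linarith)
      (by linarith) hM
  have hxs : ∀ j, j ≠ i → x j = 0 := fun j hj =>
    (Finset.sum_eq_zero_iff_of_nonneg fun j _ => hx j).1 ht j (by simp [hs, hj])
  have hn0 : n ≠ 0 := by omega
  have hP : ∏ j ∈ s, x j = 0 := by
    obtain ⟨j, hj⟩ : s.Nonempty := Finset.card_pos.1 (by omega)
    exact Finset.prod_eq_zero hj (hxs j fun h => his (h ▸ hj))
  have hE : ∑ k ∈ s, ∏ j ∈ s.erase k, x j = 0 := by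
    refine le_antisymm ?_ hE0
    simpa [ht, hn0] using hM
  obtain ⟨a, -, b, -, hab, hya, hyb⟩ := exists_pair_eq_zero (s := Finset.univ) (f := y)
    (fun j _ => hy j) (by rw [← hprod, hprodx, hP, mul_zero])
    (by rw [← hesym, hesymx, hP, hE, mul_zero, add_zero])
  have hcard2 : ({a, b} : Finset (Fin (n + 2))).card = 2 := Finset.card_pair hab
  refine ⟨hxs, {a, b}, hcard2, by simp [hya, hyb], fun j hj => ?_⟩
  have hsplit := Finset.sum_add_sum_compl ({a, b} : Finset (Fin (n + 2))) y
  rw [Finset.sum_pair hab, hya, hyb, ← hsum, hsumx, ht] at hsplit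
  have hcompl : ∑ j ∈ ({a, b} : Finset (Fin (n + 2)))ᶜ, (1 - y j) = 0 := by
    rw [Finset.sum_sub_distrib, Finset.sum_const, Finset.card_compl, hcard2, Fintype.card_fin]
    simp only [Nat.add_sub_cancel, nsmul_eq_mul, mul_one]
    linarith
  have := (Finset.sum_eq_zero_iff_of_nonneg fun j _ => sub_nonneg.2 (hy1 j)).1 hcompl j
    (Finset.mem_compl.2 hj)
  linarith

theorem four_mean_equality_case (N : ℕ) (hN : 4 ≤ N) (x y : Fin N → ℝ)
    (hx : ∀ j, 0 ≤ x j) (hy : ∀ j, 0 ≤ y j)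
    (hsum : ∑ j, x j = ∑ j, y j)
    (hprod : ∏ j, x j = ∏ j, y j)
    (hesym : ∑ k, ∏ j ∈ Finset.univ.erase k, x j
      = ∑ k, ∏ j ∈ Finset.univ.erase k, y j) :
    Finset.univ.sup' ⟨⟨0, by omega⟩, Finset.mem_univ _⟩ x
        = ((N : ℝ) - 2) * Finset.univ.sup' ⟨⟨0, by omega⟩, Finset.mem_univ _⟩ y
      ↔ ∃ c : ℝ, 0 ≤ c ∧
          (∃ i : Fin N, x i = c * ((N : ℝ) - 2) ∧ ∀ j, j ≠ i → x j = 0) ∧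
          (∃ S : Finset (Fin N), S.card = 2 ∧ (∀ j ∈ S, y j = 0) ∧
            ∀ j ∉ S, y j = c) := by
  have hne : (Finset.univ : Finset (Fin N)).Nonempty := ⟨⟨0, by omega⟩, Finset.mem_univ _⟩
  have hN4 : (4 : ℝ) ≤ N := by exact_mod_cast hN
  constructor
  · intro h
    obtain ⟨M, hM⟩ : ∃ M, M = Finset.univ.sup' hne y := ⟨_, rfl⟩
    obtain ⟨i, -, hi⟩ := Finset.exists_mem_eq_sup' hne x
    have hxi : x i = M * ((N : ℝ) - 2) := by rw [← hi, h, hM, mul_comm]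
    have hyM : ∀ j, y j ≤ M := fun j => hM ▸ Finset.le_sup' y (Finset.mem_univ j)
    have hxM : ∀ j, x j ≤ x i := fun j => hi ▸ Finset.le_sup' x (Finset.mem_univ j)
    have hM0 : 0 ≤ M := (hy i).trans (hyM i)
    refine ⟨M, hM0, ?_⟩
    rcases hM0.eq_or_lt with rfl | hMpos
    · obtain ⟨S, -, hS⟩ := Finset.exists_subset_card_eq (s := (Finset.univ : Finset (Fin N)))
        (n := 2) (by simp; omega)
      have hy0 : ∀ j, y j = 0 := fun j => le_antisymm (hyM j) (hy j)
      rw [zero_mul] at hxi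
      exact ⟨⟨i, by rw [hxi, zero_mul], fun j _ => le_antisymm (hxi ▸ hxM j) (hx j)⟩,
        S, hS, fun j _ => hy0 j, fun j _ => hy0 j⟩
    · have hscale : ∀ f : Fin N → ℝ, ∑ k, ∏ j ∈ Finset.univ.erase k, f j / M
          = (∑ k, ∏ j ∈ Finset.univ.erase k, f j) / M ^ (N - 1) := fun f => by
        rw [Finset.sum_div]
        refine Finset.sum_congr rfl fun k _ => ?_
        rw [Finset.prod_div_distrib, Finset.prod_const, Finset.card_erase_of_mem
          (Finset.mem_univ k), Finset.card_univ, Fintype.card_fin]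
      obtain ⟨hx0, S, hS, hS0, hS1⟩ := rigidity_of_le_one N hN (fun j => x j / M)
        (fun j => y j / M) (fun j => div_nonneg (hx j) hM0) (fun j => div_nonneg (hy j) hM0)
        (fun j => (div_le_one hMpos).2 (hyM j))
        (by rw [← Finset.sum_div, ← Finset.sum_div, hsum])
        (by rw [Finset.prod_div_distrib, Finset.prod_div_distrib, hprod])
        (by rw [hscale, hscale, hesym]) i
        (by rw [hxi, mul_div_cancel_left₀ _ hMpos.ne'])
      refine ⟨⟨i, hxi, fun j hj => ?_⟩, S, hS, fun j hj => ?_, fun j hj => ?_⟩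
      · simpa [hMpos.ne'] using hx0 j hj
      · simpa [hMpos.ne'] using hS0 j hj
      · exact (div_eq_one_iff_eq hMpos.ne').1 (hS1 j hj)
  · rintro ⟨c, hc, ⟨i, hxi, hx0⟩, S, hS, hS0, hS1⟩
    have hmaxx : Finset.univ.sup' hne x = c * ((N : ℝ) - 2) := by
      refine le_antisymm (Finset.sup'_le hne x fun j _ => ?_)
        (hxi ▸ Finset.le_sup' x (Finset.mem_univ i))
      rcases eq_or_ne j i with rfl | hj
      · exact hxi.le
      · rw [hx0 j hj]
        exact mul_nonneg hc (by linarith)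
    have hmaxy : Finset.univ.sup' hne y = c := by
      obtain ⟨a, ha⟩ : ∃ a, a ∉ S := by
        by_contra! hall
        have : S = Finset.univ := Finset.eq_univ_iff_forall.2 hall
        rw [this, Finset.card_univ, Fintype.card_fin] at hS
        omega
      refine le_antisymm (Finset.sup'_le hne y fun j _ => ?_)
        (hS1 a ha ▸ Finset.le_sup' y (Finset.mem_univ a))
      by_cases hj : j ∈ S
      · exact (hS0 j hj).trans_le hc
      · exact (hS1 j hj).le
    rw [hmaxx, hmaxy, mul_comm]
end

section
/- Let N ≥ 3 be an integer and let x_1,…,x_N, y_1,…,y_N be nonnegative real numbers. If ∑_{j=1}^N x_j = ∑_{j=1}^N y_j and ∏_{j=1}^N x_j = ∏_{j=1}^N y_j, then max_j x_j ≤ (N−1) · max_j y_j. -/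
/-- The Weierstrass product inequality. -/
lemma one_sub_sum_one_sub_le_prod {ι : Type*} (s : Finset ι) (y : ι → ℝ)
    (h0 : ∀ j, 0 ≤ y j) (h1 : ∀ j, y j ≤ 1) :
    1 - ∑ j ∈ s, (1 - y j) ≤ ∏ j ∈ s, y j := by
  classical
  induction s using Finset.induction_on with
  | empty => simp
  | insert a s ha ih =>
    rw [Finset.sum_insert ha, Finset.prod_insert ha]
    have hsum : 0 ≤ ∑ j ∈ s, (1 - y j) := Finset.sum_nonneg fun j _ => by linarith [h1 j]
    nlinarith [mul_le_mul_of_nonneg_left ih (h0 a), mul_nonneg (sub_nonneg.2 (h1 a)) hsum]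

lemma prod_le_sum_of_sum_le_one {ι : Type*} {s : Finset ι} (hs : s.Nonempty) {x : ι → ℝ}
    (h0 : ∀ j, 0 ≤ x j) (h1 : ∑ j ∈ s, x j ≤ 1) :
    ∏ j ∈ s, x j ≤ ∑ j ∈ s, x j := by
  classical
  obtain ⟨i, hi⟩ := hs
  have hle : ∀ j ∈ s, x j ≤ ∑ j ∈ s, x j := fun j hj =>
    Finset.single_le_sum (fun l _ => h0 l) hj
  rw [← Finset.mul_prod_erase s x hi]
  have hprod : ∏ j ∈ s.erase i, x j ≤ 1 := Finset.prod_le_one (fun j _ => h0 j)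
    fun j hj => (hle j (Finset.mem_of_mem_erase hj)).trans h1
  exact (mul_le_of_le_one_right (h0 i) hprod).trans (hle i hi)

/-- Bounding the product by the least factor times the sum of the remaining ones. -/
lemma card_mul_prod_le_sq_sum {ι : Type*} {s : Finset ι} (hs : 2 ≤ s.card) {x : ι → ℝ}
    (h0 : ∀ j, 0 ≤ x j) (h1 : ∑ j ∈ s, x j ≤ 1) :
    (s.card : ℝ) * ∏ j ∈ s, x j ≤ (∑ j ∈ s, x j) ^ 2 := by
  classical
  obtain ⟨i, hi, hmin⟩ := s.exists_min_image x (Finset.card_pos.1 (by omega))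
  have hcard : (s.card : ℝ) * x i ≤ ∑ j ∈ s, x j := by
    simpa using Finset.card_nsmul_le_sum s x (x i) hmin
  have hadd := Finset.add_sum_erase s x hi
  have hne : (s.erase i).Nonempty :=
    Finset.card_pos.1 (by rw [Finset.card_erase_of_mem hi]; omega)
  have hprod := prod_le_sum_of_sum_le_one hne h0 (by linarith [h0 i])
  rw [← Finset.mul_prod_erase s x hi, ← mul_assoc, sq]
  exact mul_le_mul hcard (by linarith [h0 i]) (Finset.prod_nonneg fun j _ => h0 j)
    (Finset.sum_nonneg fun j _ => h0 j)

lemma le_card_sub_one_of_sum_eq_of_prod_eq {N : ℕ} (hN : 3 ≤ N) {x y : Fin N → ℝ}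
    (hx : ∀ j, 0 ≤ x j) (hy : ∀ j, 0 ≤ y j) (hy1 : ∀ j, y j ≤ 1)
    (hsum : ∑ j, x j = ∑ j, y j) (hprod : ∏ j, x j = ∏ j, y j) (k : Fin N) :
    x k ≤ (N : ℝ) - 1 := by
  by_contra! hlt
  have hW := one_sub_sum_one_sub_le_prod Finset.univ y hy hy1
  have hyN : ∑ j, y j ≤ N := by simpa using Finset.sum_le_card_nsmul Finset.univ y 1 (by simpa)
  simp only [Finset.sum_sub_distrib, Finset.sum_const, Finset.card_univ, Fintype.card_fin,
    nsmul_eq_mul, mul_one] at hW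
  have hadd := Finset.add_sum_erase Finset.univ x (Finset.mem_univ k)
  have hcard : (Finset.univ.erase k).card = N - 1 := by simp
  have hbound := card_mul_prod_le_sq_sum (s := Finset.univ.erase k) (by omega) hx (by linarith)
  have hs : 0 ≤ ∑ j ∈ Finset.univ.erase k, x j := Finset.sum_nonneg fun j _ => hx j
  rw [hcard, Nat.cast_sub (by omega), Nat.cast_one] at hbound
  rw [← hprod, ← Finset.mul_prod_erase Finset.univ x (Finset.mem_univ k)] at hW
  have hP : 0 ≤ ∏ j ∈ Finset.univ.erase k, x j := Finset.prod_nonneg fun j _ => hx j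
  have hn : (2 : ℝ) ≤ (N : ℝ) - 1 := by
    have : (3 : ℝ) ≤ N := by exact_mod_cast hN
    linarith
  generalize ∑ j ∈ Finset.univ.erase k, x j = s at *
  generalize ∏ j ∈ Finset.univ.erase k, x j = P at *
  obtain ⟨n, hNn⟩ : ∃ n : ℝ, n = (N : ℝ) - 1 := ⟨_, rfl⟩
  obtain ⟨d, hd⟩ : ∃ d : ℝ, d = x k - n := ⟨_, rfl⟩
  rw [← hNn] at hlt hbound hn
  have hd0 : 0 < d := by linarith
  have hds : d + s ≤ 1 := by linarith
  have hW' : d + s ≤ n * P + d * P := by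
    rw [← add_mul, show n + d = x k by linarith]
    linarith
  have h2P : 2 * P ≤ s ^ 2 := (mul_le_mul_of_nonneg_right hn hP).trans hbound
  have hs2 : s ^ 2 ≤ s := by nlinarith
  nlinarith

theorem three_mean_theorem (N : ℕ) (hN : 3 ≤ N) (x y : Fin N → ℝ)
    (hx : ∀ j, 0 ≤ x j) (hy : ∀ j, 0 ≤ y j)
    (hsum : ∑ j, x j = ∑ j, y j)
    (hprod : ∏ j, x j = ∏ j, y j) :
    Finset.univ.sup' ⟨⟨0, by omega⟩, Finset.mem_univ _⟩ x
      ≤ ((N : ℝ) - 1) * Finset.univ.sup' ⟨⟨0, by omega⟩, Finset.mem_univ _⟩ y := by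
  have hyM : ∀ j, y j ≤ Finset.univ.sup' ⟨⟨0, by omega⟩, Finset.mem_univ _⟩ y :=
    fun j => Finset.le_sup' y (Finset.mem_univ j)
  generalize Finset.univ.sup' ⟨⟨0, by omega⟩, Finset.mem_univ _⟩ y = M at *
  refine Finset.sup'_le _ _ fun k _ => ?_
  have hM : 0 ≤ M := (hy k).trans (hyM k)
  rcases hM.eq_or_lt with rfl | hM
  · have hy0 : ∑ j, y j = 0 := Finset.sum_eq_zero fun j _ => le_antisymm (hyM j) (hy j)
    have := Finset.single_le_sum (fun j _ => hx j) (Finset.mem_univ k)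
    linarith
  · rw [← div_le_iff₀ hM]
    refine le_card_sub_one_of_sum_eq_of_prod_eq hN (x := fun j => x j / M) (y := fun j => y j / M)
      (fun j => div_nonneg (hx j) hM.le) (fun j => div_nonneg (hy j) hM.le)
      (fun j => (div_le_one hM).2 (hyM j)) ?_ ?_ k
    · rw [← Finset.sum_div, ← Finset.sum_div, hsum]
    · rw [Finset.prod_div_distrib, Finset.prod_div_distrib, hprod]
end

section
/- Let N ≥ 4 be an integer and define the real polynomial f(t) = t^{2N−2} − (N−1)t^N + (N−1)t^{N−2} − 1. Then for every real t > 0 with t ≠ 1, f(t) ≠ 0. -/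
/-- Strict AM-GM for the even powers `1, t ^ 2, …, t ^ (2 * n)`. -/
theorem succ_mul_pow_lt_sum_pow_sq {n : ℕ} (hn : n ≠ 0) {t : ℝ} (ht : 0 < t) (ht1 : t ≠ 1) :
    ((n : ℝ) + 1) * t ^ n < ∑ i ∈ Finset.range (n + 1), (t ^ 2) ^ i := by
  have amgm : ∀ i ∈ Finset.range (n + 1),
      (t ^ 2) ^ i + (t ^ 2) ^ (n - i) - 2 * t ^ n = (t ^ i - t ^ (n - i)) ^ 2 := by
    intro i hi
    have hsplit : t ^ n = t ^ i * t ^ (n - i) := by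
      rw [← pow_add, Nat.add_sub_cancel' (Finset.mem_range_succ_iff.mp hi)]
    rw [hsplit, pow_right_comm t 2 i, pow_right_comm t 2 (n - i)]
    ring
  have hpos : 0 < ∑ i ∈ Finset.range (n + 1), ((t ^ 2) ^ i + (t ^ 2) ^ (n - i) - 2 * t ^ n) := by
    rw [Finset.sum_congr rfl amgm]
    refine Finset.sum_pos' (fun i _ => sq_nonneg _) ⟨0, by simp, ?_⟩
    have hne : t ^ n ≠ 1 := fun h => ht1 ((pow_eq_one_iff_of_nonneg ht.le hn).mp h)
    have : t ^ 0 - t ^ (n - 0) ≠ 0 := by simpa [sub_eq_zero] using hne.symm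
    positivity
  have hreflect : ∑ i ∈ Finset.range (n + 1), (t ^ 2) ^ (n - i)
      = ∑ i ∈ Finset.range (n + 1), (t ^ 2) ^ i := by
    simpa using Finset.sum_range_reflect (fun i => (t ^ 2) ^ i) (n + 1)
  rw [Finset.sum_sub_distrib, Finset.sum_add_distrib, hreflect] at hpos
  simp only [Finset.sum_const, Finset.card_range, nsmul_eq_mul, Nat.cast_add, Nat.cast_one] at hpos
  linarith

theorem poly_f_ne_zero (N : ℕ) (hN : 4 ≤ N) (t : ℝ) (ht : 0 < t) (ht1 : t ≠ 1) :
    t ^ (2 * N - 2) - ((N : ℝ) - 1) * t ^ N + ((N : ℝ) - 1) * t ^ (N - 2) - 1 ≠ 0 := by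
  obtain ⟨n, rfl⟩ : ∃ n, N = n + 2 := ⟨N - 2, by omega⟩
  have hlt := succ_mul_pow_lt_sum_pow_sq (n := n) (by omega) ht ht1
  have hsq : t ^ 2 - 1 ≠ 0 := fun h =>
    ht1 ((pow_eq_one_iff_of_nonneg ht.le two_ne_zero).mp (sub_eq_zero.mp h))
  have hfactor : t ^ (2 * (n + 2) - 2) - (((n + 2 : ℕ) : ℝ) - 1) * t ^ (n + 2)
      + (((n + 2 : ℕ) : ℝ) - 1) * t ^ (n + 2 - 2) - 1
      = (∑ i ∈ Finset.range (n + 1), (t ^ 2) ^ i - ((n : ℝ) + 1) * t ^ n) * (t ^ 2 - 1) := by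
    rw [sub_mul (∑ i ∈ Finset.range (n + 1), (t ^ 2) ^ i), geom_sum_mul, ← pow_mul,
      show 2 * (n + 2) - 2 = 2 * (n + 1) by omega,
      Nat.add_sub_cancel]
    push_cast
    ring
  rw [hfactor]
  exact mul_ne_zero (sub_pos.mpr hlt).ne' hsq
end

section
/- Let N ≥ 4 be an integer and let r be an integer with 1 ≤ r ≤ N−1. Define g(u,v) = (N−1)u^N − (N−r)u^{N−1} − r·v·u^{N−1} + v^r. Then g(u,v) ≠ 0 for all real u, v with 0 < u < v < 1 (in fact g(u,v) > 0 there). -/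
theorem pow_succ_sub_succ_mul_pow_add_nonneg {a b : ℝ} (ha : 0 ≤ a) (hb : 0 ≤ b) (k : ℕ) :
    0 ≤ b ^ (k + 1) - ((k : ℝ) + 1) * b * a ^ k + k * a ^ (k + 1) := by
  induction k with
  | zero => simp
  | succ k ih =>
    have hstep : b ^ (k + 1 + 1) - (((k + 1 : ℕ) : ℝ) + 1) * b * a ^ (k + 1)
        + ((k + 1 : ℕ) : ℝ) * a ^ (k + 1 + 1)
        = b * (b ^ (k + 1) - ((k : ℝ) + 1) * b * a ^ k + k * a ^ (k + 1))
          + ((k : ℝ) + 1) * a ^ k * (b - a) ^ 2 := by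
      push_cast
      ring
    rw [hstep]
    positivity

theorem poly_g_pos (N r : ℕ) (hN : 4 ≤ N) (hr1 : 1 ≤ r) (hrN : r ≤ N - 1)
    (u v : ℝ) (hu : 0 < u) (huv : u < v) (hv : v < 1) :
    0 < ((N : ℝ) - 1) * u ^ N - ((N : ℝ) - (r : ℝ)) * u ^ (N - 1)
      - (r : ℝ) * v * u ^ (N - 1) + v ^ r := by
  obtain ⟨k, rfl⟩ : ∃ k, N = r + k + 1 := ⟨N - 1 - r, by omega⟩
  have hv0 : 0 < v := hu.trans huv
  have hdiag := mul_nonneg (pow_nonneg hv0.le r)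
    (pow_succ_sub_succ_mul_pow_add_nonneg hv0.le zero_le_one k)
  have hoff := pow_succ_sub_succ_mul_pow_add_nonneg hu.le hv0.le (r + k)
  have hpow : 0 < v ^ (r + k) - u ^ (r + k) :=
    sub_pos.2 (pow_lt_pow_left₀ huv hu.le (by omega))
  have hgap : 0 < ((k : ℝ) + 1) * (1 - v) * (v ^ (r + k) - u ^ (r + k)) :=
    mul_pos (mul_pos (by positivity) (sub_pos.2 hv)) hpow
  have hsum := add_pos_of_pos_of_nonneg hgap (add_nonneg hdiag hoff)
  rw [Nat.add_sub_cancel]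
  refine hsum.trans_eq ?_
  push_cast
  ring
end

section
/- Let N ≥ 4 and let A, B be N×N complex matrices with super-identical pseudospectra. Then for every polynomial p with complex coefficients, trace(p(A)ᴴ · p(A)) = trace(p(B)ᴴ · p(B)); equivalently, the sums of the squared singular values of p(A) and of p(B) agree. -/
open Matrix Polynomial

/-- Two `N × N` complex matrices have *super-identical pseudospectra* if, for every `z ∈ ℂ`,
the Hermitian matrices `(A - zI)ᴴ(A - zI)` and `(B - zI)ᴴ(B - zI)` have the same
characteristic polynomial. -/
def SuperIdenticalPseudospectra {N : ℕ} (A B : Matrix (Fin N) (Fin N) ℂ) : Prop :=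
  ∀ z : ℂ, ((A - z • 1)ᴴ * (A - z • 1)).charpoly = ((B - z • 1)ᴴ * (B - z • 1)).charpoly

open Filter Bornology Topology

namespace Matrix

section Polarization

variable {n : Type*} [Fintype n] [DecidableEq n]

/-- A polynomial matrix in the variables `x, y` which specializes to
`(D - (x - iy))(A - (x + iy))`. -/
noncomputable def shiftedProduct (D A : Matrix n n ℂ) :
    Matrix n n (MvPolynomial (Fin 2) ℂ) :=
  (D.map MvPolynomial.C -
      (MvPolynomial.X 0 - MvPolynomial.C Complex.I * MvPolynomial.X 1 : MvPolynomial (Fin 2) ℂ) • 1) *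
    (A.map MvPolynomial.C -
      (MvPolynomial.X 0 + MvPolynomial.C Complex.I * MvPolynomial.X 1 : MvPolynomial (Fin 2) ℂ) • 1)

theorem shiftedProduct_map_eval (D A : Matrix n n ℂ) (x : Fin 2 → ℂ) :
    (shiftedProduct D A).map (MvPolynomial.eval x) =
      (D - (x 0 - Complex.I * x 1) • 1) * (A - (x 0 + Complex.I * x 1) • 1) := by
  have key (E : Matrix n n ℂ) (s : MvPolynomial (Fin 2) ℂ) :
      (E.map MvPolynomial.C - s • 1).map (MvPolynomial.eval x) =
        E - MvPolynomial.eval x s • 1 := by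
    ext i j
    by_cases hij : i = j <;> simp [hij]
  rw [shiftedProduct, Matrix.map_mul, key, key]
  simp

/-- Equality of the characteristic polynomials of `(Aᴴ - z̄)(A - z)` and `(Bᴴ - z̄)(B - z)` for
all `z` persists when `z̄` is replaced by an independent variable `w`. -/
theorem charpoly_sub_mul_sub_eq {A B : Matrix n n ℂ}
    (h : ∀ z : ℂ, ((A - z • 1)ᴴ * (A - z • 1)).charpoly = ((B - z • 1)ᴴ * (B - z • 1)).charpoly)
    (z w : ℂ) :
    ((Aᴴ - w • 1) * (A - z • 1)).charpoly = ((Bᴴ - w • 1) * (B - z • 1)).charpoly := by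
  have hpoly : (shiftedProduct Aᴴ A).charpoly = (shiftedProduct Bᴴ B).charpoly := by
    ext1 k
    refine MvPolynomial.funext_set (fun _ ↦ Set.range ((↑) : ℝ → ℂ))
      (fun _ ↦ Set.infinite_range_of_injective Complex.ofReal_injective) fun x hx ↦ ?_
    obtain ⟨a, ha⟩ := hx 0 trivial
    obtain ⟨b, hb⟩ := hx 1 trivial
    rw [← Polynomial.coeff_map, ← Polynomial.coeff_map, ← charpoly_map, ← charpoly_map,
      shiftedProduct_map_eval, shiftedProduct_map_eval]
    have := h (x 0 + Complex.I * x 1)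
    simp only [conjTranspose_sub, conjTranspose_smul, conjTranspose_one] at this
    have hs : star (x 0 + Complex.I * x 1) = x 0 - Complex.I * x 1 := by
      simp [← ha, ← hb, sub_eq_add_neg]
    rw [hs] at this
    rw [this]
  have := congrArg (Polynomial.map (MvPolynomial.eval ![(z + w) / 2, (z - w) / (2 * Complex.I)]))
    hpoly
  rw [← charpoly_map, ← charpoly_map, shiftedProduct_map_eval, shiftedProduct_map_eval] at this
  have hz : (z + w) / 2 + Complex.I * ((z - w) / (2 * Complex.I)) = z := by
    field_simp [Complex.I_ne_zero]
    ring
  have hw : (z + w) / 2 - Complex.I * ((z - w) / (2 * Complex.I)) = w := by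
    field_simp [Complex.I_ne_zero]
    ring
  simpa [hz, hw] using this

end Polarization

section Trace

variable {n : Type*} [Fintype n] [DecidableEq n]

theorem trace_inv_eq_of_charpoly_eq {K : Type*} [Field K] {A B : Matrix n n K} (hA : IsUnit A)
    (hB : IsUnit B) (h : A.charpoly = B.charpoly) : A⁻¹.trace = B⁻¹.trace := by
  rw [trace_eq_neg_charpoly_nextCoeff, trace_eq_neg_charpoly_nextCoeff, charpoly_inv _ hA,
    charpoly_inv _ hB, ← reverse_charpoly, ← reverse_charpoly, h, det_eq_sign_charpoly_coeff A,
    det_eq_sign_charpoly_coeff B, h]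

attribute [local instance] Matrix.linftyOpNormedRing Matrix.linftyOpNormedAlgebra

theorem eventually_isUnit_sub (A : Matrix n n ℂ) :
    ∀ᶠ z in cobounded ℂ, IsUnit (A - z • (1 : Matrix n n ℂ)) := by
  filter_upwards [spectrum.eventually_isUnit_resolvent (𝕜 := ℂ) A] with z hz
  have := spectrum.isUnit_resolvent.mpr hz
  simpa [spectrum.mem_resolventSet_iff, Algebra.algebraMap_eq_smul_one] using IsUnit.neg this

theorem tendsto_trace_inv_sub_mul (A M : Matrix n n ℂ) :
    Tendsto (fun z : ℂ ↦ ((A - z • 1)⁻¹ * M).trace) (cobounded ℂ) (𝓝 0) := by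
  have h := spectrum.resolvent_tendsto_cobounded (𝕜 := ℂ) A
  have hc : Continuous fun R : Matrix n n ℂ ↦ (-R * M).trace :=
    ((continuous_id.neg).matrix_mul continuous_const).matrix_trace
  have := (hc.tendsto 0).comp h
  simp only [neg_zero, zero_mul, trace_zero] at this
  refine this.congr' ?_
  filter_upwards [eventually_isUnit_sub A] with z hz
  have hinv : (-(A - z • 1))⁻¹ = -(A - z • 1)⁻¹ := inv_eq_left_inv <| by
    rw [neg_mul_neg, nonsing_inv_mul _ ((isUnit_iff_isUnit_det _).mp hz)]
  rw [Function.comp_apply, resolvent, Algebra.algebraMap_eq_smul_one, ← neg_sub A,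
    ← nonsing_inv_eq_ringInverse, hinv, neg_neg]

theorem mul_trace_inv_sub_mul {A : Matrix n n ℂ} {z : ℂ} (hz : IsUnit (A - z • 1))
    (M : Matrix n n ℂ) :
    z * ((A - z • 1)⁻¹ * M).trace = ((A - z • 1)⁻¹ * (A * M)).trace - M.trace := by
  have h : (A - z • 1)⁻¹ * (A - z • 1) = 1 :=
    nonsing_inv_mul _ ((isUnit_iff_isUnit_det _).mp hz)
  calc z * ((A - z • 1)⁻¹ * M).trace
      = ((A - z • 1)⁻¹ * (A * M)).trace - ((A - z • 1)⁻¹ * (A - z • 1) * M).trace := by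
        simp [Matrix.mul_assoc, Matrix.sub_mul, Matrix.mul_sub]
    _ = _ := by rw [h, Matrix.one_mul]

theorem trace_eq_and_eventually_trace_inv {A B M M' : Matrix n n ℂ}
    (h : ∀ᶠ z in cobounded ℂ, ((A - z • 1)⁻¹ * M).trace = ((B - z • 1)⁻¹ * M').trace) :
    M.trace = M'.trace ∧ ∀ᶠ z in cobounded ℂ,
      ((A - z • 1)⁻¹ * (A * M)).trace = ((B - z • 1)⁻¹ * (B * M')).trace := by
  have hrec : ∀ᶠ z in cobounded ℂ, ((A - z • 1)⁻¹ * (A * M)).trace -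
      ((B - z • 1)⁻¹ * (B * M')).trace = M.trace - M'.trace := by
    filter_upwards [h, eventually_isUnit_sub A, eventually_isUnit_sub B] with z hz hA hB
    have h1 := mul_trace_inv_sub_mul hA M
    have h2 := mul_trace_inv_sub_mul hB M'
    rw [hz] at h1
    linear_combination h2 - h1
  have hlim := ((tendsto_trace_inv_sub_mul A (A * M)).sub
    (tendsto_trace_inv_sub_mul B (B * M'))).congr' hrec
  rw [sub_zero] at hlim
  have h0 : M.trace - M'.trace = 0 := tendsto_nhds_unique tendsto_const_nhds hlim
  refine ⟨sub_eq_zero.mp h0, ?_⟩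
  filter_upwards [hrec] with z hz
  rwa [h0, sub_eq_zero] at hz

/-- If the traces of two weighted resolvents agree near infinity, then so do the
corresponding weighted moments. -/
theorem trace_pow_mul_eq_of_eventually_trace_inv {A B M M' : Matrix n n ℂ}
    (h : ∀ᶠ z in cobounded ℂ, ((A - z • 1)⁻¹ * M).trace = ((B - z • 1)⁻¹ * M').trace) (k : ℕ) :
    (A ^ k * M).trace = (B ^ k * M').trace := by
  induction k generalizing M M' with
  | zero => simpa using (trace_eq_and_eventually_trace_inv h).1
  | succ k ih =>
    simpa only [pow_succ, Matrix.mul_assoc] using ih (trace_eq_and_eventually_trace_inv h).2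

end Trace

/-- The mixed moments `tr((Aᴴ)ʲ Aᵏ)` are determined by the characteristic polynomials of
`(A - z)ᴴ(A - z)`, `z ∈ ℂ`. -/
theorem trace_conjTranspose_pow_mul_pow_eq {n : Type*} [Fintype n] [DecidableEq n]
    {A B : Matrix n n ℂ}
    (h : ∀ z : ℂ, ((A - z • 1)ᴴ * (A - z • 1)).charpoly = ((B - z • 1)ᴴ * (B - z • 1)).charpoly)
    (j k : ℕ) : (Aᴴ ^ j * A ^ k).trace = (Bᴴ ^ j * B ^ k).trace := by
  refine trace_pow_mul_eq_of_eventually_trace_inv ?_ j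
  filter_upwards [eventually_isUnit_sub Aᴴ, eventually_isUnit_sub Bᴴ] with w hAw hBw
  rw [trace_mul_comm, trace_mul_comm _ (B ^ k)]
  refine trace_pow_mul_eq_of_eventually_trace_inv ?_ k
  filter_upwards [eventually_isUnit_sub A, eventually_isUnit_sub B] with z hAz hBz
  rw [← mul_inv_rev, ← mul_inv_rev]
  exact trace_inv_eq_of_charpoly_eq (hAw.mul hAz) (hBw.mul hBz) (charpoly_sub_mul_sub_eq h z w)

theorem trace_conjTranspose_aeval_mul_aeval {n : Type*} [Fintype n] [DecidableEq n]
    (A : Matrix n n ℂ) (p : ℂ[X]) :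
    ((aeval A p)ᴴ * aeval A p).trace = ∑ j ∈ Finset.range (p.natDegree + 1),
      ∑ k ∈ Finset.range (p.natDegree + 1),
        star (p.coeff j) * (p.coeff k * (Aᴴ ^ j * A ^ k).trace) := by
  simp [aeval_eq_sum_range, conjTranspose_sum, Finset.sum_mul_sum, trace_sum, mul_left_comm]

end Matrix

theorem trace_eq_of_superIdenticalPseudospectra (N : ℕ) (hN : 4 ≤ N)
    (A B : Matrix (Fin N) (Fin N) ℂ) (hAB : SuperIdenticalPseudospectra A B)
    (p : Polynomial ℂ) :
    Matrix.trace ((aeval A p)ᴴ * aeval A p) = Matrix.trace ((aeval B p)ᴴ * aeval B p) := by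
  simp only [trace_conjTranspose_aeval_mul_aeval, trace_conjTranspose_pow_mul_pow_eq hAB]
end

section
/- Let N ≥ 4 and let A, B be N×N complex matrices with super-identical pseudospectra. Then for every polynomial p with complex coefficients, det(p(A)ᴴ · p(A)) = det(p(B)ᴴ · p(B)); equivalently, the products of the squared singular values of p(A) and of p(B) agree. -/
open Matrix Polynomial

/-- The Gram determinant of `p(A)` is multiplicative in the polynomial `p`. -/
theorem Matrix.det_conjTranspose_mul_self_aeval_mul {n : Type*} [Fintype n] [DecidableEq n]
    (A : Matrix n n ℂ) (p q : Polynomial ℂ) :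
    ((aeval A (p * q))ᴴ * aeval A (p * q)).det =
      ((aeval A p)ᴴ * aeval A p).det * ((aeval A q)ᴴ * aeval A q).det := by
  simp only [map_mul, det_mul, det_conjTranspose, star_mul']
  ring

/-- Super-identical pseudospectra give equal Gram determinants of all shifts. -/
theorem SuperIdenticalPseudospectra.det_shift_eq {N : ℕ} {A B : Matrix (Fin N) (Fin N) ℂ}
    (hAB : SuperIdenticalPseudospectra A B) (z : ℂ) :
    ((A - z • 1)ᴴ * (A - z • 1)).det = ((B - z • 1)ᴴ * (B - z • 1)).det := by
  rw [det_eq_sign_charpoly_coeff, hAB z, ← det_eq_sign_charpoly_coeff]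

theorem det_eq_of_superIdenticalPseudospectra (N : ℕ) (hN : 4 ≤ N)
    (A B : Matrix (Fin N) (Fin N) ℂ) (hAB : SuperIdenticalPseudospectra A B)
    (p : Polynomial ℂ) :
    ((aeval A p)ᴴ * aeval A p).det = ((aeval B p)ᴴ * aeval B p).det := by
  rw [(IsAlgClosed.splits p).eq_prod_roots, det_conjTranspose_mul_self_aeval_mul,
    det_conjTranspose_mul_self_aeval_mul, aeval_C, aeval_C]
  congr 1
  induction p.roots using Multiset.induction_on with
  | empty => simp
  | cons z s ih =>
    rw [Multiset.map_cons, Multiset.prod_cons, det_conjTranspose_mul_self_aeval_mul,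
      det_conjTranspose_mul_self_aeval_mul, ih]
    congr 1
    simpa only [map_sub, aeval_X, aeval_C, Algebra.algebraMap_eq_smul_one] using
      hAB.det_shift_eq z
end

section
/- Let N ≥ 4 and let A, B be N×N complex matrices with super-identical pseudospectra. Then for every polynomial p with complex coefficients, the coefficient of X^1 in the characteristic polynomial of p(A)ᴴ · p(A) equals the coefficient of X^1 in the characteristic polynomial of p(B)ᴴ · p(B); equivalently, ∑_{k=1}^N ∏_{j≠k} s_j(p(A))² = ∑_{k=1}^N ∏_{j≠k} s_j(p(B))², where s_1,…,s_N denote the singular values. -/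
open Matrix Polynomial

theorem Matrix.derivative_det {n R : Type*} [Fintype n] [DecidableEq n] [CommRing R]
    (M : Matrix n n R[X]) :
    derivative M.det = ∑ i, (M.updateRow i fun j => derivative (M i j)).det := by
  simp only [← det_transpose M,
    ← fun i => det_transpose (M.updateRow i fun j => derivative (M i j)),
    det_apply, derivative_sum, Units.smul_def, derivative_smul, transpose_apply]
  rw [Finset.sum_comm]
  refine Finset.sum_congr rfl fun σ _ => ?_
  rw [derivative_prod_finset, Finset.smul_sum]
  refine Finset.sum_congr rfl fun i _ => ?_
  rw [← Finset.prod_erase_mul _ _ (Finset.mem_univ i), updateRow_self]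
  congr 2
  refine Finset.prod_congr rfl fun j hj => ?_
  rw [updateRow_ne (Finset.ne_of_mem_erase hj)]

theorem Matrix.derivative_charpoly {n R : Type*} [Fintype n] [DecidableEq n] [CommRing R]
    (M : Matrix n n R) :
    derivative M.charpoly = (adjugate (charmatrix M)).trace := by
  rw [charpoly, Matrix.derivative_det, trace]
  refine Finset.sum_congr rfl fun i _ => ?_
  rw [diag_apply, adjugate_apply]
  congr 2
  ext1 j
  by_cases h : i = j
  · subst h; simp
  · simp [h, Ne.symm h]

theorem Matrix.map_eval_charmatrix {n R : Type*} [Fintype n] [DecidableEq n] [CommRing R]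
    (M : Matrix n n R) (z : R) :
    (evalRingHom z).mapMatrix (charmatrix M) = z • 1 - M := by
  ext i j
  by_cases h : i = j
  · subst h; simp
  · simp [h]

theorem Matrix.charpoly_coeff_one {n R : Type*} [Fintype n] [DecidableEq n] [CommRing R]
    (M : Matrix n n R) :
    M.charpoly.coeff 1 = (-1) ^ (Fintype.card n - 1) * M.adjugate.trace := by
  have h : M.charpoly.coeff 1 = (derivative M.charpoly).eval 0 := by
    simp [← coeff_zero_eq_eval_zero, coeff_derivative]
  rw [h, derivative_charpoly, ← coe_evalRingHom, AddMonoidHom.map_trace, ← RingHom.mapMatrix_apply,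
    RingHom.map_adjugate, map_eval_charmatrix, zero_smul, zero_sub, ← neg_one_smul R M,
    adjugate_smul, trace_smul, smul_eq_mul]

theorem Matrix.det_smul_one_sub {n R : Type*} [Fintype n] [DecidableEq n] [CommRing R]
    (A : Matrix n n R) (z : R) : (z • 1 - A).det = A.charpoly.eval z := by
  rw [eval_charpoly, scalar_apply, smul_one_eq_diagonal]

theorem Matrix.eval_charpoly_smul_adjugate {n R : Type*} [Fintype n] [DecidableEq n]
    [CommRing R] (A : Matrix n n R) (z : R) :
    A.charpoly.eval z • adjugate (z • 1 - A)
      = A.charpoly.eval z • aeval A (A.charpoly /ₘ (X - C z)) := by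
  have h : (z • 1 - A) * aeval A (A.charpoly /ₘ (X - C z)) = A.charpoly.eval z • 1 := by
    have := congrArg (aeval A) (X_sub_C_mul_divByMonic_eq_sub_modByMonic A.charpoly z)
    rw [modByMonic_X_sub_C_eq_C_eval] at this
    simp only [map_mul, map_sub, aeval_X, aeval_C, aeval_self_charpoly, zero_sub,
      Algebra.algebraMap_eq_smul_one] at this
    rw [← neg_sub, neg_mul, this, neg_neg]
  have := congrArg (adjugate (z • 1 - A) * ·) h
  simp only [← mul_assoc, adjugate_mul, det_smul_one_sub, smul_mul_assoc, one_mul,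
    mul_smul_comm, mul_one] at this
  exact this.symm

theorem Matrix.adjugate_smul_one_sub {n R : Type*} [Fintype n] [DecidableEq n]
    [CommRing R] (A : Matrix n n R) (z : R) :
    adjugate (z • 1 - A) = aeval A (A.charpoly /ₘ (X - C z)) := by
  have h := eval_charpoly_smul_adjugate (A.map C) (X : R[X])
  have hc : (A.map C).charpoly.eval X = A.charpoly := by
    rw [charpoly_map, eval_map, eval₂_C_X]
  have hm : (X : R[X]) • 1 - A.map C = charmatrix A := by
    rw [charmatrix, scalar_apply, smul_one_eq_diagonal]; rfl
  rw [hc, hm] at h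
  have h' : adjugate (charmatrix A) = aeval (A.map C) ((A.map C).charpoly /ₘ (X - C X)) := by
    ext1 i j
    exact A.charpoly_monic.isRegular.left (by simpa using congrFun (congrFun h i) j)
  have h2 := congrArg (evalRingHom z).mapMatrix h'
  rw [RingHom.map_adjugate, map_eval_charmatrix] at h2
  have halg : (evalRingHom z).mapMatrix.comp (algebraMap R[X] (Matrix n n R[X]))
      = (algebraMap R (Matrix n n R)).comp (evalRingHom z) := by
    refine RingHom.ext fun x => ?_
    ext i j
    by_cases h : i = j <;> simp [algebraMap_matrix_apply, h]
  have hA : (evalRingHom z).mapMatrix (A.map C) = A := by ext i j; simp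
  rw [h2, aeval_def, hom_eval₂, charpoly_map, aeval_def, halg, hA, ← eval₂_map,
    map_divByMonic _ (monic_X_sub_C _), Polynomial.map_map]
  have hid : (evalRingHom z).comp C = RingHom.id R := by ext x; simp
  simp [hid]

/-- A complex polynomial in two variables is determined by its values at the points `(z̄, z)`. -/
theorem MvPolynomial.eq_of_eval_conj_eq {P Q : MvPolynomial (Fin 2) ℂ}
    (h : ∀ z : ℂ, MvPolynomial.eval ![star z, z] P = MvPolynomial.eval ![star z, z] Q) : P = Q := by
  let g : Fin 2 → MvPolynomial (Fin 2) ℂ :=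
    ![.X 0 - .C Complex.I * .X 1, .X 0 + .C Complex.I * .X 1]
  have hg : ∀ (x : Fin 2 → ℂ) (P : MvPolynomial (Fin 2) ℂ),
      MvPolynomial.eval x (MvPolynomial.bind₁ g P) =
        MvPolynomial.eval ![x 0 - Complex.I * x 1, x 0 + Complex.I * x 1] P := by
    intro x P
    rw [← MvPolynomial.coe_aeval_eq_eval, RingHom.coe_coe, MvPolynomial.aeval_bind₁,
      ← MvPolynomial.coe_aeval_eq_eval, RingHom.coe_coe]
    congr 2
    ext i
    fin_cases i <;> simp [g]
  have key : MvPolynomial.bind₁ g P = MvPolynomial.bind₁ g Q := by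
    refine MvPolynomial.funext_set (fun _ => Set.range ((↑) : ℝ → ℂ))
      (fun _ => Set.infinite_range_of_injective Complex.ofReal_injective) fun x hx => ?_
    obtain ⟨s, hs⟩ := hx 0 trivial
    obtain ⟨t, ht⟩ := hx 1 trivial
    have := h (s + Complex.I * t)
    rw [hg, hg, ← hs, ← ht]
    simpa [sub_eq_add_neg] using this
  refine MvPolynomial.funext fun x => ?_
  have := congrArg (MvPolynomial.eval
    ![(x 0 + x 1) / 2, (x 0 - x 1) / 2 * Complex.I]) key
  rw [hg, hg] at this
  convert this using 2 <;> congr 1 <;> ext i <;> fin_cases i <;> simp <;> ring_nf <;> simp <;> ring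

theorem Polynomial.coeff_divX_iterate {R : Type*} [Semiring R] (f : R[X]) (m k : ℕ) :
    (divX^[m] f).coeff k = f.coeff (k + m) := by
  induction m generalizing k with
  | zero => simp
  | succ m ih => rw [Function.iterate_succ_apply', coeff_divX, ih, add_assoc, add_comm 1]

theorem Polynomial.X_sub_C_mul_sum_divX_iterate {R : Type*} [CommRing R] (f : R[X]) (z : R)
    (m : ℕ) :
    (X - C z) * ∑ k ∈ Finset.range m, C (z ^ k) * divX^[k + 1] f
      = f - ∑ k ∈ Finset.range m, C (f.coeff k * z ^ k) - C (z ^ m) * divX^[m] f := by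
  induction m with
  | zero => simp
  | succ m ih =>
    have h := divX_mul_X_add (divX^[m] f)
    rw [← Function.iterate_succ_apply' divX m f, coeff_divX_iterate, zero_add] at h
    rw [Finset.sum_range_succ, Finset.sum_range_succ, mul_add, ih, ← h]
    simp only [C_mul, C_pow]
    ring

theorem Polynomial.divX_iterate_eq_zero {R : Type*} [Semiring R] {f : R[X]} {m : ℕ}
    (h : f.natDegree < m) : divX^[m] f = 0 := by
  ext k
  rw [coeff_divX_iterate, coeff_zero]
  exact coeff_eq_zero_of_natDegree_lt (by omega)

theorem Polynomial.divByMonic_X_sub_C_eq_sum_divX_iterate {R : Type*} [CommRing R] (f : R[X])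
    (z : R) :
    f /ₘ (X - C z) = ∑ k ∈ Finset.range (f.natDegree + 1), C (z ^ k) * divX^[k + 1] f := by
  refine (monic_X_sub_C z).isRegular.left ?_
  simp only
  rw [X_sub_C_mul_divByMonic_eq_sub_modByMonic, modByMonic_X_sub_C_eq_C_eval,
    X_sub_C_mul_sum_divX_iterate, divX_iterate_eq_zero (Nat.lt_succ_self _), mul_zero, sub_zero,
    eval_eq_sum_range, map_sum]

theorem Polynomial.Monic.degree_divX_iterate {R : Type*} [Semiring R] [Nontrivial R] {f : R[X]}
    (hf : f.Monic) {i : ℕ} (hi : i ≤ f.natDegree) :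
    (divX^[f.natDegree - i] f).degree = i ∧ (divX^[f.natDegree - i] f).Monic := by
  have hc : (divX^[f.natDegree - i] f).coeff i = 1 := by
    rw [coeff_divX_iterate, Nat.add_sub_cancel' hi, hf.coeff_natDegree]
  have hle : (divX^[f.natDegree - i] f).natDegree ≤ i := by
    rw [natDegree_le_iff_coeff_eq_zero]
    intro k hk
    rw [coeff_divX_iterate]
    exact coeff_eq_zero_of_natDegree_lt (by omega)
  have hm := monic_of_natDegree_le_of_coeff_eq_one i hle hc
  refine ⟨?_, hm⟩
  exact degree_eq_of_le_of_coeff_ne_zero (natDegree_le_iff_degree_le.mp hle) (by simp [hc])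

/-- A subspace of `R[X]` containing all multiples of a monic `f` and all the quotients of `f` by
powers of `X` is everything. -/
theorem Polynomial.Monic.eq_top_of_divX_iterate_mem {R : Type*} [CommRing R] [Nontrivial R]
    {f : R[X]} (hf : f.Monic) (S : Submodule R R[X]) (hmul : ∀ q, q * f ∈ S)
    (hdiv : ∀ k, divX^[k] f ∈ S) : S = ⊤ := by
  have hpow : ∀ k, (X ^ k * f).Monic := fun k => (monic_X_pow k).mul hf
  let T : Polynomial.Sequence R :=
    { elems' := fun i => if i ≤ f.natDegree then divX^[f.natDegree - i] f
        else X ^ (i - f.natDegree) * f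
      degree_eq' := fun i => by
        split_ifs with h
        · exact (hf.degree_divX_iterate h).1
        · rw [degree_eq_natDegree (hpow _).ne_zero, (monic_X_pow _).natDegree_mul hf,
            natDegree_X_pow, Nat.sub_add_cancel (by omega)] }
  have hT : ∀ i, T i = if i ≤ f.natDegree then divX^[f.natDegree - i] f
        else X ^ (i - f.natDegree) * f := fun _ => rfl
  rw [eq_top_iff, ← T.span, Submodule.span_le]
  · rintro _ ⟨i, rfl⟩
    rw [hT]
    split_ifs
    exacts [hdiv _, hmul _]
  · intro i
    rw [hT]
    split_ifs with h
    · simp [(hf.degree_divX_iterate h).2.leadingCoeff]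
    · simp [(hpow _).leadingCoeff]

theorem Matrix.linearMap_aeval_eq {n K : Type*} [Fintype n] [DecidableEq n] [Field K] [Infinite K]
    {A B : Matrix n n K} (hχ : A.charpoly = B.charpoly) (φ ψ : Matrix n n K →ₗ[K] K)
    (h : ∀ z : K, φ (adjugate (z • 1 - A)) = ψ (adjugate (z • 1 - B))) (r : K[X]) :
    φ (aeval A r) = ψ (aeval B r) := by
  let L : K[X] →ₗ[K] K := φ ∘ₗ (aeval A).toLinearMap - ψ ∘ₗ (aeval B).toLinearMap
  have hL : ∀ q, L q = φ (aeval A q) - ψ (aeval B q) := fun _ => rfl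
  suffices L.ker = ⊤ by
    have hr : r ∈ L.ker := this ▸ Submodule.mem_top
    rwa [LinearMap.mem_ker, hL, sub_eq_zero] at hr
  have hmul : ∀ q, L (q * A.charpoly) = 0 := fun q => by
    have hB : aeval B A.charpoly = 0 := hχ ▸ aeval_self_charpoly B
    simp [hL, aeval_self_charpoly, hB]
  have hz : ∀ z, L (A.charpoly /ₘ (X - C z)) = 0 := fun z => by
    rw [hL, ← adjugate_smul_one_sub, hχ, ← adjugate_smul_one_sub, h, sub_self]
  have hdiv : ∀ k, L (divX^[k + 1] A.charpoly) = 0 := by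
    intro k
    by_cases hk : k < A.charpoly.natDegree + 1
    · have hg : ∑ k ∈ Finset.range (A.charpoly.natDegree + 1),
          C (L (divX^[k + 1] A.charpoly)) * X ^ k = 0 := by
        refine Polynomial.funext fun z => ?_
        have := hz z
        rw [divByMonic_X_sub_C_eq_sum_divX_iterate, map_sum] at this
        simp only [← smul_eq_C_mul, map_smul, smul_eq_mul] at this
        simpa only [eval_finsetSum, eval_mul, eval_C, eval_pow, eval_X, eval_zero, mul_comm]
          using this
      have := congrArg (coeff · k) hg
      simpa only [finsetSum_coeff, coeff_C_mul_X_pow, Finset.sum_ite_eq, Finset.mem_range, hk,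
        if_true, coeff_zero] using this
    · rw [divX_iterate_eq_zero (by omega), map_zero]
  refine A.charpoly_monic.eq_top_of_divX_iterate_mem _ hmul fun k => ?_
  cases k with
  | zero => simpa using hmul 1
  | succ k => exact hdiv k

theorem Matrix.adjugate_aeval_X_sub_C {n R : Type*} [Fintype n] [DecidableEq n] [CommRing R]
    (A : Matrix n n R) (z : R) :
    adjugate (aeval A (X - C z)) =
      aeval A (C ((-1) ^ (Fintype.card n - 1)) * (A.charpoly /ₘ (X - C z))) := by
  rw [map_mul, ← adjugate_smul_one_sub, aeval_C, ← Algebra.smul_def, ← adjugate_smul]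
  simp [Algebra.algebraMap_eq_smul_one]

theorem Matrix.exists_adjugate_aeval_eq {n K : Type*} [Fintype n] [DecidableEq n] [Field K]
    [IsAlgClosed K] {A B : Matrix n n K} (hχ : A.charpoly = B.charpoly) (p : K[X]) :
    ∃ r : K[X], adjugate (aeval A p) = aeval A r ∧ adjugate (aeval B p) = aeval B r := by
  have hmul : ∀ p q : K[X],
      (∃ r : K[X], adjugate (aeval A p) = aeval A r ∧ adjugate (aeval B p) = aeval B r) →
      (∃ r : K[X], adjugate (aeval A q) = aeval A r ∧ adjugate (aeval B q) = aeval B r) →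
      ∃ r : K[X], adjugate (aeval A (p * q)) = aeval A r ∧
        adjugate (aeval B (p * q)) = aeval B r := by
    rintro p q ⟨r, hA, hB⟩ ⟨s, hA', hB'⟩
    exact ⟨s * r, by simp [adjugate_mul_distrib, hA, hA'], by simp [adjugate_mul_distrib, hB, hB']⟩
  have hC : ∀ (M : Matrix n n K) (c : K),
      adjugate (aeval M (C c)) = aeval M (C (c ^ (Fintype.card n - 1))) := fun M c => by
    simp only [aeval_C, Algebra.algebraMap_eq_smul_one, adjugate_smul, adjugate_one]
  rw [(IsAlgClosed.splits p).eq_prod_roots]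
  refine hmul _ _ ⟨_, hC A _, hC B _⟩ ?_
  induction p.roots using Multiset.induction_on with
  | empty => exact ⟨_, hC A 1, hC B 1⟩
  | cons z s ih =>
    rw [Multiset.map_cons, Multiset.prod_cons]
    exact hmul _ _ ⟨_, adjugate_aeval_X_sub_C A z, hχ ▸ adjugate_aeval_X_sub_C B z⟩ ih

theorem Matrix.conjTranspose_aeval {n : Type*} [Fintype n] [DecidableEq n]
    (A : Matrix n n ℂ) (r : ℂ[X]) :
    (aeval A r)ᴴ = aeval Aᴴ (r.map (starRingEnd ℂ)) := by
  induction r using Polynomial.induction_on' with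
  | add p q hp hq => simp [hp, hq]
  | monomial k a =>
    simp [aeval_monomial, Algebra.algebraMap_eq_smul_one, conjTranspose_pow]

/-- The matrix `X i • 1 - A` over the polynomials in two variables. -/
noncomputable def genericCharmatrix {n : Type*} [DecidableEq n] (i : Fin 2) (A : Matrix n n ℂ) :
    Matrix n n (MvPolynomial (Fin 2) ℂ) :=
  (MvPolynomial.X i : MvPolynomial (Fin 2) ℂ) • 1 - A.map MvPolynomial.C

theorem eval_genericCharmatrix {n : Type*} [Fintype n] [DecidableEq n] (i : Fin 2)
    (A : Matrix n n ℂ) (x : Fin 2 → ℂ) :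
    (MvPolynomial.eval x).mapMatrix (genericCharmatrix i A) = x i • 1 - A := by
  ext j k
  by_cases h : j = k <;> simp [genericCharmatrix, h]

theorem SuperIdenticalPseudospectra.charpoly_eq_smul_one_sub {N : ℕ}
    {A B : Matrix (Fin N) (Fin N) ℂ} (h : SuperIdenticalPseudospectra A B) (z : ℂ) :
    ((star z • 1 - Aᴴ) * (z • 1 - A)).charpoly = ((star z • 1 - Bᴴ) * (z • 1 - B)).charpoly := by
  have key : ∀ M : Matrix (Fin N) (Fin N) ℂ,
      (M - z • 1)ᴴ * (M - z • 1) = (star z • 1 - Mᴴ) * (z • 1 - M) := fun M => by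
    rw [← neg_sub, conjTranspose_neg, neg_mul_neg, conjTranspose_sub, conjTranspose_smul,
      conjTranspose_one]
  simpa only [key] using h z

theorem SuperIdenticalPseudospectra.det_mul_det_eq {N : ℕ}
    {A B : Matrix (Fin N) (Fin N) ℂ} (h : SuperIdenticalPseudospectra A B) (w z : ℂ) :
    (w • 1 - Aᴴ).det * (z • 1 - A).det = (w • 1 - Bᴴ).det * (z • 1 - B).det := by
  have key : (genericCharmatrix 0 Aᴴ).det * (genericCharmatrix 1 A).det
      = (genericCharmatrix 0 Bᴴ).det * (genericCharmatrix 1 B).det := by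
    refine MvPolynomial.eq_of_eval_conj_eq fun z => ?_
    simp only [map_mul, RingHom.map_det, eval_genericCharmatrix, ← det_mul]
    simp only [cons_val_zero, cons_val_one]
    rw [det_eq_sign_charpoly_coeff, h.charpoly_eq_smul_one_sub, ← det_eq_sign_charpoly_coeff]
  simpa only [map_mul, RingHom.map_det, eval_genericCharmatrix, cons_val_zero, cons_val_one] using
    congrArg (MvPolynomial.eval ![w, z]) key

theorem SuperIdenticalPseudospectra.trace_adjugate_mul_adjugate_eq {N : ℕ}
    {A B : Matrix (Fin N) (Fin N) ℂ} (h : SuperIdenticalPseudospectra A B) (w z : ℂ) :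
    (adjugate (z • 1 - A) * adjugate (w • 1 - Aᴴ)).trace
      = (adjugate (z • 1 - B) * adjugate (w • 1 - Bᴴ)).trace := by
  have key : (adjugate (genericCharmatrix 1 A) * adjugate (genericCharmatrix 0 Aᴴ)).trace
      = (adjugate (genericCharmatrix 1 B) * adjugate (genericCharmatrix 0 Bᴴ)).trace := by
    refine MvPolynomial.eq_of_eval_conj_eq fun z => ?_
    simp only [AddMonoidHom.map_trace, ← RingHom.mapMatrix_apply, map_mul, RingHom.map_adjugate,
      eval_genericCharmatrix, ← adjugate_mul_distrib]
    have := congrArg (coeff · 1) (h.charpoly_eq_smul_one_sub z)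
    simp only [charpoly_coeff_one] at this
    exact mul_left_cancel₀ (pow_ne_zero _ (by simp)) this
  simpa only [AddMonoidHom.map_trace, ← RingHom.mapMatrix_apply, map_mul, RingHom.map_adjugate,
    eval_genericCharmatrix, cons_val_zero, cons_val_one] using congrArg (MvPolynomial.eval ![w, z]) key

theorem SuperIdenticalPseudospectra.charpoly_eq {N : ℕ}
    {A B : Matrix (Fin N) (Fin N) ℂ} (h : SuperIdenticalPseudospectra A B) :
    A.charpoly = B.charpoly := by
  obtain ⟨w, hw⟩ : ∃ w, Aᴴ.charpoly.eval w ≠ 0 := by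
    by_contra! H
    exact Aᴴ.charpoly_monic.ne_zero (Polynomial.funext fun w => by simpa using H w)
  have hmul : C (Aᴴ.charpoly.eval w) * A.charpoly = C (Bᴴ.charpoly.eval w) * B.charpoly := by
    refine Polynomial.funext fun z => ?_
    simpa only [eval_mul, eval_C, det_smul_one_sub] using h.det_mul_det_eq w z
  have hlead := congrArg leadingCoeff hmul
  simp only [leadingCoeff_mul, leadingCoeff_C, A.charpoly_monic.leadingCoeff,
    B.charpoly_monic.leadingCoeff, mul_one] at hlead
  rw [← hlead] at hmul
  exact mul_left_cancel₀ (C_ne_zero.mpr hw) hmul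

theorem Matrix.charpoly_conjTranspose {n : Type*} [Fintype n] [DecidableEq n] (A : Matrix n n ℂ) :
    Aᴴ.charpoly = A.charpoly.map (starRingEnd ℂ) := by
  rw [← charpoly_map, ← charpoly_transpose (A.map _)]
  rfl

theorem SuperIdenticalPseudospectra.trace_aeval_mul_aeval_eq {N : ℕ}
    {A B : Matrix (Fin N) (Fin N) ℂ} (h : SuperIdenticalPseudospectra A B) (r s : ℂ[X]) :
    (aeval A r * aeval Aᴴ s).trace = (aeval B r * aeval Bᴴ s).trace := by
  have hχ := h.charpoly_eq
  have hχ' : Aᴴ.charpoly = Bᴴ.charpoly := by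
    rw [charpoly_conjTranspose, hχ, charpoly_conjTranspose]
  have hr : ∀ w : ℂ, (aeval A r * adjugate (w • 1 - Aᴴ)).trace
      = (aeval B r * adjugate (w • 1 - Bᴴ)).trace := fun w =>
    linearMap_aeval_eq hχ (traceLinearMap _ ℂ ℂ ∘ₗ LinearMap.mulRight ℂ (adjugate (w • 1 - Aᴴ)))
      (traceLinearMap _ ℂ ℂ ∘ₗ LinearMap.mulRight ℂ (adjugate (w • 1 - Bᴴ)))
      (fun z => h.trace_adjugate_mul_adjugate_eq w z) r
  exact linearMap_aeval_eq hχ' (traceLinearMap _ ℂ ℂ ∘ₗ LinearMap.mulLeft ℂ (aeval A r))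
    (traceLinearMap _ ℂ ℂ ∘ₗ LinearMap.mulLeft ℂ (aeval B r)) hr s

theorem charpoly_coeff_one_eq_of_superIdenticalPseudospectra (N : ℕ) (hN : 4 ≤ N)
    (A B : Matrix (Fin N) (Fin N) ℂ) (hAB : SuperIdenticalPseudospectra A B)
    (p : Polynomial ℂ) :
    (((aeval A p)ᴴ * aeval A p).charpoly).coeff 1
      = (((aeval B p)ᴴ * aeval B p).charpoly).coeff 1 := by
  obtain ⟨r, hA, hB⟩ := exists_adjugate_aeval_eq hAB.charpoly_eq p
  rw [charpoly_coeff_one, charpoly_coeff_one, adjugate_mul_distrib, adjugate_mul_distrib,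
    ← adjugate_conjTranspose, ← adjugate_conjTranspose, hA, hB, conjTranspose_aeval,
    conjTranspose_aeval, hAB.trace_aeval_mul_aeval_eq]
end

section
/- Let α, β ∈ (0, π/4] and let A be the 4×4 complex matrix with rows (0, sec α, 0, 1), (0, 0, sec β · csc β, 0), (0, 0, 0, csc α), (0, 0, 0, 0), and B the 4×4 complex matrix with rows (0, sec β, 0, 1), (0, 0, sec α · csc α, 0), (0, 0, 0, csc β), (0, 0, 0, 0). Then A and B have super-identical pseudospectra, i.e., for every z ∈ ℂ the matrices (A − zI)ᴴ(A − zI) and (B − zI)ᴴ(B − zI) have the same characteristic polynomial. -/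
open Matrix

/-- The shifted matrix `A - z I` for a nilpotent `A` with superdiagonal `a, c, b` and corner `1`. -/
def shiftedNilpotent {R : Type*} [CommRing R] (a c b z : R) : Matrix (Fin 4) (Fin 4) R :=
  !![-z, a, 0, 1; 0, -z, c, 0; 0, 0, -z, b; 0, 0, 0, -z]

theorem det_sub_transpose_mul_shiftedNilpotent {R : Type*} [CommRing R] (a c b z w t : R) :
    (scalar (Fin 4) t - (shiftedNilpotent a c b w)ᵀ * shiftedNilpotent a c b z).det =
      t ^ 4 - (4 * (z * w) + a ^ 2 + b ^ 2 + c ^ 2 + 1) * t ^ 3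
      + (6 * (z * w) ^ 2 + 2 * (z * w) * (a ^ 2 + b ^ 2 + c ^ 2 + 1)
          + a ^ 2 * b ^ 2 + c ^ 2 + c ^ 2 * (a ^ 2 + b ^ 2)) * t ^ 2
      - (4 * (z * w) ^ 3 + (z * w) ^ 2 * (a ^ 2 + b ^ 2 + c ^ 2 + 1)
          + z * w * (c ^ 2 * (a ^ 2 + b ^ 2)) + a ^ 2 * b ^ 2 * c ^ 2
          + a * b * c * (z ^ 2 + w ^ 2)) * t
      + (z * w) ^ 4 := by
  have h : scalar (Fin 4) t - (shiftedNilpotent a c b w)ᵀ * shiftedNilpotent a c b z =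
      !![t - z * w, w * a, 0, w;
         a * z, t - (a ^ 2 + z * w), w * c, -a;
         0, c * z, t - (c ^ 2 + z * w), w * b;
         z, -a, b * z, t - (1 + b ^ 2 + z * w)] := by
    ext i j
    fin_cases i <;> fin_cases j <;>
      simp [shiftedNilpotent, Matrix.mul_apply, Fin.sum_univ_four] <;> ring
  rw [h]
  simp [det_succ_row_zero, Fin.sum_univ_succ, Fin.succAbove]
  ring

/-- Two shifted nilpotent matrices have equal Gram determinants when the middle entry of each is the
product of the outer entries of the other and the outer entries satisfy `a² + b² = a² b²`. -/
theorem det_sub_transpose_mul_shiftedNilpotent_swap {R : Type*} [CommRing R] {a b p q : R}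
    (hab : a ^ 2 + b ^ 2 = a ^ 2 * b ^ 2) (hpq : p ^ 2 + q ^ 2 = p ^ 2 * q ^ 2) (z w t : R) :
    (scalar (Fin 4) t
        - (shiftedNilpotent a (p * q) b w)ᵀ * shiftedNilpotent a (p * q) b z).det =
      (scalar (Fin 4) t
        - (shiftedNilpotent p (a * b) q w)ᵀ * shiftedNilpotent p (a * b) q z).det := by
  simp only [det_sub_transpose_mul_shiftedNilpotent, add_assoc (4 * (z * w)), hab, hpq]
  ring

theorem inv_cos_sq_add_inv_sin_sq {θ : ℝ} (hθ : θ ∈ Set.Ioc 0 (Real.pi / 4)) :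
    ((Real.cos θ : ℂ))⁻¹ ^ 2 + ((Real.sin θ : ℂ))⁻¹ ^ 2 =
      ((Real.cos θ : ℂ))⁻¹ ^ 2 * ((Real.sin θ : ℂ))⁻¹ ^ 2 := by
  have hpi := Real.pi_pos
  have hs : (Real.sin θ : ℂ) ≠ 0 := by
    exact_mod_cast (Real.sin_pos_of_pos_of_lt_pi hθ.1 (by linarith [hθ.2])).ne'
  have hc : (Real.cos θ : ℂ) ≠ 0 := by
    exact_mod_cast
      (Real.cos_pos_of_mem_Ioo ⟨by linarith [hθ.1], by linarith [hθ.2]⟩).ne'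
  have h : (Real.sin θ : ℂ) ^ 2 + (Real.cos θ : ℂ) ^ 2 = 1 := by
    exact_mod_cast Real.sin_sq_add_cos_sq θ
  field_simp
  exact h

theorem example_superIdenticalPseudospectra (α β : ℝ)
    (hα : α ∈ Set.Ioc 0 (Real.pi / 4)) (hβ : β ∈ Set.Ioc 0 (Real.pi / 4))
    (A B : Matrix (Fin 4) (Fin 4) ℂ)
    (hA : A = !![0, ((Real.cos α : ℂ))⁻¹, 0, 1;
                 0, 0, ((Real.cos β : ℂ))⁻¹ * ((Real.sin β : ℂ))⁻¹, 0;
                 0, 0, 0, ((Real.sin α : ℂ))⁻¹;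
                 0, 0, 0, 0])
    (hB : B = !![0, ((Real.cos β : ℂ))⁻¹, 0, 1;
                 0, 0, ((Real.cos α : ℂ))⁻¹ * ((Real.sin α : ℂ))⁻¹, 0;
                 0, 0, 0, ((Real.sin β : ℂ))⁻¹;
                 0, 0, 0, 0]) :
    ∀ z : ℂ, ((A - z • 1)ᴴ * (A - z • 1)).charpoly
      = ((B - z • 1)ᴴ * (B - z • 1)).charpoly := by
  intro z
  have sub_smul_one (a c b : ℂ) :
      !![0, a, 0, 1; 0, 0, c, 0; 0, 0, 0, b; 0, 0, 0, 0] - z • 1 = shiftedNilpotent a c b z := by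
    ext i j
    fin_cases i <;> fin_cases j <;> simp [shiftedNilpotent]
  have conjTranspose_eq {a c b : ℂ} (ha : star a = a) (hc : star c = c) (hb : star b = b) :
      (shiftedNilpotent a c b z)ᴴ = (shiftedNilpotent a c b (star z))ᵀ := by
    ext i j
    fin_cases i <;> fin_cases j <;> simp_all [shiftedNilpotent]
  have star_inv_ofReal (r : ℝ) : star ((r : ℂ)⁻¹) = (r : ℂ)⁻¹ := by simp
  have star_mul_inv_ofReal (r s : ℝ) : star ((r : ℂ)⁻¹ * (s : ℂ)⁻¹) = (r : ℂ)⁻¹ * (s : ℂ)⁻¹ := by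
    simp
  refine Polynomial.funext fun t => ?_
  rw [eval_charpoly, eval_charpoly, hA, hB, sub_smul_one, sub_smul_one,
    conjTranspose_eq (star_inv_ofReal _) (star_mul_inv_ofReal _ _) (star_inv_ofReal _),
    conjTranspose_eq (star_inv_ofReal _) (star_mul_inv_ofReal _ _) (star_inv_ofReal _)]
  exact det_sub_transpose_mul_shiftedNilpotent_swap (inv_cos_sq_add_inv_sin_sq hα)
    (inv_cos_sq_add_inv_sin_sq hβ) z (star z) t
end

section
/- Let α, β ∈ (0, π/4] and let A be the 4×4 complex matrix with rows (0, sec α, 0, 1), (0, 0, sec β · csc β, 0), (0, 0, 0, csc α), (0, 0, 0, 0), and B the 4×4 complex matrix with rows (0, sec β, 0, 1), (0, 0, sec α · csc α, 0), (0, 0, 0, csc β), (0, 0, 0, 0). Then the characteristic polynomial of (A²)ᴴ(A²) equals X²·(X − (sec α · sec β · csc β)²)·(X − (csc α · sec β · csc β)²), and the characteristic polynomial of (B²)ᴴ(B²) equals X²·(X − (sec β · sec α · csc α)²)·(X − (csc β · sec α · csc α)²); in particular the singular values of A² are csc α · sec β · csc β ≥ sec α · sec β · csc β ≥ 0 = 0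 and those of B² are csc β · sec α · csc α ≥ sec β · sec α · csc α ≥ 0 = 0, so that s₁(A²)/s₁(B²) = cos α/cos β and s₂(A²)/s₂(B²) = sin α/sin β. -/
open Matrix Polynomial

/-- The `4 × 4` matrix with superdiagonal `p, q, r` and corner entry `1` has a square whose only
nonzero entries are `p * q` and `q * r`, so its Gram matrix is diagonal. -/
theorem conjTranspose_sq_mul_sq_eq_diagonal (p q r : ℝ) :
    ((!![0, (p : ℂ), 0, 1; 0, 0, (q : ℂ), 0; 0, 0, 0, (r : ℂ); 0, 0, 0, 0] :
        Matrix (Fin 4) (Fin 4) ℂ) ^ 2)ᴴ *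
      (!![0, (p : ℂ), 0, 1; 0, 0, (q : ℂ), 0; 0, 0, 0, (r : ℂ); 0, 0, 0, 0] :
        Matrix (Fin 4) (Fin 4) ℂ) ^ 2 =
      diagonal ![0, 0, ((p * q : ℝ) : ℂ) ^ 2, ((r * q : ℝ) : ℂ) ^ 2] := by
  ext i j
  fin_cases i <;> fin_cases j <;>
    simp [pow_two, Matrix.mul_apply, Fin.sum_univ_four] <;> ring

theorem charpoly_conjTranspose_sq_mul_sq (p q r : ℝ) :
    (((!![0, (p : ℂ), 0, 1; 0, 0, (q : ℂ), 0; 0, 0, 0, (r : ℂ); 0, 0, 0, 0] :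
        Matrix (Fin 4) (Fin 4) ℂ) ^ 2)ᴴ *
      (!![0, (p : ℂ), 0, 1; 0, 0, (q : ℂ), 0; 0, 0, 0, (r : ℂ); 0, 0, 0, 0] :
        Matrix (Fin 4) (Fin 4) ℂ) ^ 2).charpoly =
      X ^ 2 * (X - C (((p * q : ℝ) : ℂ) ^ 2)) * (X - C (((r * q : ℝ) : ℂ) ^ 2)) := by
  rw [conjTranspose_sq_mul_sq_eq_diagonal, charpoly_diagonal]
  simp [Fin.prod_univ_four, pow_two]

theorem sin_pos_and_sin_le_cos_of_mem_Ioc {t : ℝ} (ht : t ∈ Set.Ioc 0 (Real.pi / 4)) :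
    0 < Real.sin t ∧ Real.sin t ≤ Real.cos t := by
  obtain ⟨h0, h1⟩ := ht
  have hpi := Real.pi_pos
  refine ⟨Real.sin_pos_of_pos_of_lt_pi h0 (by linarith), ?_⟩
  rw [← Real.sin_pi_div_two_sub]
  exact Real.sin_le_sin_of_le_of_le_pi_div_two (by linarith) (by linarith) (by linarith)

theorem example_charpoly_and_singular_value_ratios (α β : ℝ)
    (hα : α ∈ Set.Ioc 0 (Real.pi / 4)) (hβ : β ∈ Set.Ioc 0 (Real.pi / 4))
    (A B : Matrix (Fin 4) (Fin 4) ℂ)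
    (hA : A = !![0, ((Real.cos α : ℂ))⁻¹, 0, 1;
                 0, 0, ((Real.cos β : ℂ))⁻¹ * ((Real.sin β : ℂ))⁻¹, 0;
                 0, 0, 0, ((Real.sin α : ℂ))⁻¹;
                 0, 0, 0, 0])
    (hB : B = !![0, ((Real.cos β : ℂ))⁻¹, 0, 1;
                 0, 0, ((Real.cos α : ℂ))⁻¹ * ((Real.sin α : ℂ))⁻¹, 0;
                 0, 0, 0, ((Real.sin β : ℂ))⁻¹;
                 0, 0, 0, 0]) :
    ((A ^ 2)ᴴ * (A ^ 2)).charpoly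
        = X ^ 2 * (X - C ((((Real.cos α)⁻¹ * (Real.cos β)⁻¹ * (Real.sin β)⁻¹ : ℝ) ^ 2 : ℂ)))
            * (X - C ((((Real.sin α)⁻¹ * (Real.cos β)⁻¹ * (Real.sin β)⁻¹ : ℝ) ^ 2 : ℂ))) ∧
    ((B ^ 2)ᴴ * (B ^ 2)).charpoly
        = X ^ 2 * (X - C ((((Real.cos β)⁻¹ * (Real.cos α)⁻¹ * (Real.sin α)⁻¹ : ℝ) ^ 2 : ℂ)))
            * (X - C ((((Real.sin β)⁻¹ * (Real.cos α)⁻¹ * (Real.sin α)⁻¹ : ℝ) ^ 2 : ℂ))) ∧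
    (0 : ℝ) ≤ (Real.cos α)⁻¹ * (Real.cos β)⁻¹ * (Real.sin β)⁻¹ ∧
    (Real.cos α)⁻¹ * (Real.cos β)⁻¹ * (Real.sin β)⁻¹
        ≤ (Real.sin α)⁻¹ * (Real.cos β)⁻¹ * (Real.sin β)⁻¹ ∧
    (0 : ℝ) ≤ (Real.cos β)⁻¹ * (Real.cos α)⁻¹ * (Real.sin α)⁻¹ ∧
    (Real.cos β)⁻¹ * (Real.cos α)⁻¹ * (Real.sin α)⁻¹
        ≤ (Real.sin β)⁻¹ * (Real.cos α)⁻¹ * (Real.sin α)⁻¹ ∧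
    ((Real.sin α)⁻¹ * (Real.cos β)⁻¹ * (Real.sin β)⁻¹)
        / ((Real.sin β)⁻¹ * (Real.cos α)⁻¹ * (Real.sin α)⁻¹) = Real.cos α / Real.cos β ∧
    ((Real.cos α)⁻¹ * (Real.cos β)⁻¹ * (Real.sin β)⁻¹)
        / ((Real.cos β)⁻¹ * (Real.cos α)⁻¹ * (Real.sin α)⁻¹) = Real.sin α / Real.sin β := by
  obtain ⟨hsα, hscα⟩ := sin_pos_and_sin_le_cos_of_mem_Ioc hα
  obtain ⟨hsβ, hscβ⟩ := sin_pos_and_sin_le_cos_of_mem_Ioc hβ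
  have hcα : 0 < Real.cos α := hsα.trans_le hscα
  have hcβ : 0 < Real.cos β := hsβ.trans_le hscβ
  refine ⟨?_, ?_, by positivity, by gcongr, by positivity, by gcongr, by field_simp, by field_simp⟩
  · have h := charpoly_conjTranspose_sq_mul_sq (Real.cos α)⁻¹
      ((Real.cos β)⁻¹ * (Real.sin β)⁻¹) (Real.sin α)⁻¹
    simp only [← mul_assoc] at h
    rw [hA, ← h]
    push_cast
    rfl
  · have h := charpoly_conjTranspose_sq_mul_sq (Real.cos β)⁻¹
      ((Real.cos α)⁻¹ * (Real.sin α)⁻¹) (Real.sin β)⁻¹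
    simp only [← mul_assoc] at h
    rw [hB, ← h]
    push_cast
    rfl
end
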